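/- arXiv:1011.5438 — 5 statements merged into one kernel-verified Lean document; each statement's English description precedes it below -/
import Mathlib

section
/- For any finite set A of integers with |A| ≥ 5, we have |A + 4·A| ≥ 5|A| − 6. -/
open Finset Pointwise

set_option maxHeartbeats 2000000

/-- residue class mod 4 -/
def cl (c : ℤ) (Z : Finset ℤ) : Finset ℤ := Z.filter (fun z => z % 4 = c)
/-- compressed residue class -/
def Xi (i : ℤ) (A : Finset ℤ) : Finset ℤ := (cl i A).image (fun a => a / 4)
/-- A + 4A -/
def S4 (A : Finset ℤ) : Finset ℤ := A + A.image (fun b => (4 : ℤ) * b)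

lemma mem_cl {c : ℤ} {Z : Finset ℤ} {z : ℤ} : z ∈ cl c Z ↔ z ∈ Z ∧ z % 4 = c := by
  simp [cl]

lemma cl_sub (c : ℤ) (Z : Finset ℤ) : cl c Z ⊆ Z := Finset.filter_subset _ _

lemma card_split (Z : Finset ℤ) :
    Z.card = (cl 0 Z).card + (cl 1 Z).card + (cl 2 Z).card + (cl 3 Z).card := by
  have h : Z = ((cl 0 Z ∪ cl 1 Z) ∪ cl 2 Z) ∪ cl 3 Z := by
    ext z
    simp only [Finset.mem_union, mem_cl]
    constructor
    · intro hz
      simp only [hz, true_and]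
      omega
    · tauto
  have d (U : Finset ℤ) (c : ℤ) (hU : ∀ z ∈ U, z % 4 ≠ c) : Disjoint U (cl c Z) := by
    rw [Finset.disjoint_left]
    intro z hz hz'
    exact hU z hz (mem_cl.1 hz').2
  conv_lhs => rw [h]
  rw [Finset.card_union_of_disjoint, Finset.card_union_of_disjoint, Finset.card_union_of_disjoint]
  all_goals
    apply d
    intro z hz
    simp only [Finset.mem_union, mem_cl] at hz
    omega

lemma add_card {X Y : Finset ℤ} (hX : 0 < X.card) (hY : 0 < Y.card) :
    X.card + Y.card ≤ (X + Y).card + 1 := by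
  have := cauchy_davenport_add_of_linearOrder_isCancelAdd (Finset.card_pos.1 hX)
    (Finset.card_pos.1 hY)
  omega

lemma cl_add (X A : Finset ℤ) (e m c : ℤ) (h : (e + m) % 4 = c) :
    cl e X + cl m A ⊆ cl c (X + A) := by
  intro z hz
  obtain ⟨x, hx, y, hy, rfl⟩ := Finset.mem_add.1 hz
  rw [mem_cl] at *
  exact ⟨Finset.add_mem_add hx.1 hy.1, by omega⟩

lemma cl_add_le (X A : Finset ℤ) (e m c : ℤ) (h : (e + m) % 4 = c) :
    (cl e X + cl m A).card ≤ (cl c (X + A)).card :=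
  Finset.card_le_card (cl_add X A e m c h)

lemma affine (k t : ℤ) (hk : k ≠ 0) (B : Finset ℤ) :
    (S4 (B.image (fun x => k * x + t))).card = (S4 B).card := by
  have : S4 (B.image (fun x => k * x + t)) = (S4 B).image (fun x => k * x + 5 * t) := by
    ext z
    simp only [S4, Finset.mem_add, Finset.mem_image]
    constructor
    · rintro ⟨_, ⟨x, hx, rfl⟩, _, ⟨_, ⟨y, hy, rfl⟩, rfl⟩, rfl⟩
      exact ⟨x + 4 * y, ⟨x, hx, _, ⟨y, hy, rfl⟩, rfl⟩, by ring⟩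
    · rintro ⟨_, ⟨x, hx, _, ⟨y, hy, rfl⟩, rfl⟩, rfl⟩
      exact ⟨_, ⟨x, hx, rfl⟩, _, ⟨_, ⟨y, hy, rfl⟩, rfl⟩, by ring⟩
  rw [this, Finset.card_image_of_injective]
  intro a b hab
  simpa [hk] using hab

lemma card_affine (k t : ℤ) (hk : k ≠ 0) (B : Finset ℤ) :
    (B.image (fun x => k * x + t)).card = B.card := by
  rw [Finset.card_image_of_injective]
  intro a b hab
  simpa [hk] using hab

lemma Xi_image (i : ℤ) (A : Finset ℤ) : (Xi i A).image (fun x => 4 * x + i) = cl i A := by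
  ext z
  simp only [Xi, Finset.mem_image, mem_cl]
  constructor
  · rintro ⟨_, ⟨x, hx, rfl⟩, rfl⟩
    have : 4 * (x / 4) + i = x := by omega
    rw [this]; exact hx
  · intro hz
    exact ⟨z / 4, ⟨z, hz, rfl⟩, by omega⟩

lemma Xi_card (i : ℤ) (A : Finset ℤ) : (Xi i A).card = (cl i A).card := by
  rw [← Xi_image, card_affine 4 i (by norm_num)]

lemma cl_S4 (i : ℤ) (A : Finset ℤ) :
    cl i (S4 A) = (Xi i A + A).image (fun x => 4 * x + i) := by
  ext z
  simp only [S4, Finset.mem_image, mem_cl, Finset.mem_add]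
  constructor
  · rintro ⟨⟨x, hx, _, ⟨y, hy, rfl⟩, rfl⟩, h⟩
    refine ⟨x / 4 + y, ⟨x / 4, ?_, y, hy, rfl⟩, by omega⟩
    exact Finset.mem_image.2 ⟨x, mem_cl.2 ⟨hx, by omega⟩, rfl⟩
  · rintro ⟨_, ⟨x, hx, y, hy, rfl⟩, rfl⟩
    obtain ⟨w, hw, rfl⟩ := Finset.mem_image.1 hx
    rw [mem_cl] at hw
    exact ⟨⟨w, hw.1, _, ⟨y, hy, rfl⟩, by omega⟩, by omega⟩

lemma S4_split (A : Finset ℤ) : (S4 A).card =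
    (Xi 0 A + A).card + (Xi 1 A + A).card + (Xi 2 A + A).card + (Xi 3 A + A).card := by
  rw [card_split (S4 A)]
  simp only [cl_S4]
  simp only [card_affine 4 _ (by norm_num : (4:ℤ) ≠ 0)]

lemma F_eq (i : ℤ) (A : Finset ℤ) : (Xi i A + cl i A).card = (S4 (Xi i A)).card := by
  have : Xi i A + cl i A = (S4 (Xi i A)).image (fun x => 1 * x + i) := by
    conv_lhs => rw [← Xi_image]
    ext z
    simp only [S4, Finset.mem_add, Finset.mem_image]
    constructor
    · rintro ⟨x, hx, _, ⟨y, hy, rfl⟩, rfl⟩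
      exact ⟨_, ⟨x, hx, _, ⟨y, hy, rfl⟩, rfl⟩, by ring⟩
    · rintro ⟨_, ⟨x, hx, _, ⟨y, hy, rfl⟩, rfl⟩, rfl⟩
      exact ⟨x, hx, _, ⟨y, hy, rfl⟩, by ring⟩
  rw [this, card_affine 1 i (by norm_num)]

lemma W_split (X A : Finset ℤ) (m : ℤ) : (X + cl m A).card =
    (cl 0 X + cl m A).card + (cl 1 X + cl m A).card + (cl 2 X + cl m A).card
      + (cl 3 X + cl m A).card := by
  have key (e c : ℤ) (he : e % 4 = e) (hc : c = (e + m) % 4) :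
      cl c (X + cl m A) = cl e X + cl m A := by
    ext z
    simp only [Finset.mem_add, mem_cl]
    constructor
    · rintro ⟨⟨x, hx, y, hy, rfl⟩, h⟩
      exact ⟨x, ⟨hx, by omega⟩, y, hy, rfl⟩
    · rintro ⟨x, hx, y, hy, rfl⟩
      exact ⟨⟨x, hx.1, y, hy, rfl⟩, by omega⟩
  rw [← key 0 _ (by norm_num) rfl, ← key 1 _ (by norm_num) rfl, ← key 2 _ (by norm_num) rfl,
    ← key 3 _ (by norm_num) rfl, card_split (X + cl m A)]
  have hm : m % 4 = 0 ∨ m % 4 = 1 ∨ m % 4 = 2 ∨ m % 4 = 3 := by omega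
  rcases hm with h | h | h | h
  · rw [show (0 + m) % 4 = 0 by omega, show (1 + m) % 4 = 1 by omega,
      show (2 + m) % 4 = 2 by omega, show (3 + m) % 4 = 3 by omega]
  · rw [show (0 + m) % 4 = 1 by omega, show (1 + m) % 4 = 2 by omega,
      show (2 + m) % 4 = 3 by omega, show (3 + m) % 4 = 0 by omega]; ring
  · rw [show (0 + m) % 4 = 2 by omega, show (1 + m) % 4 = 3 by omega,
      show (2 + m) % 4 = 0 by omega, show (3 + m) % 4 = 1 by omega]; ring
  · rw [show (0 + m) % 4 = 3 by omega, show (1 + m) % 4 = 0 by omega,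
      show (2 + m) % 4 = 1 by omega, show (3 + m) % 4 = 2 by omega]; ring

lemma bonus (X A : Finset ℤ) (hX : 0 < X.card) (hA : 0 < A.card) : ∃ p q : ℤ, ∀ m : ℤ,
    0 < (cl m A).card →
    (X + cl m A).card + (if m = p then 0 else 1) + (if m = q then 0 else 1) ≤ (X + A).card := by
  have hX' := Finset.card_pos.1 hX
  have hA' := Finset.card_pos.1 hA
  refine ⟨(A.min' hA') % 4, (A.max' hA') % 4, ?_⟩
  intro m hm
  obtain ⟨u, hu⟩ := Finset.card_pos.1 hm
  have hu' := mem_cl.1 hu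
  have hu1 := A.min'_le u hu'.1
  have hu2 := A.le_max' u hu'.1
  have hxx := X.min'_le _ (X.max'_mem hX')
  have hsub : X + cl m A ⊆ X + A := Finset.add_subset_add_left (cl_sub m A)
  have hlo : X.min' hX' + A.min' hA' ∈ X + A :=
    Finset.add_mem_add (X.min'_mem _) (A.min'_mem _)
  have hhi : X.max' hX' + A.max' hA' ∈ X + A :=
    Finset.add_mem_add (X.max'_mem _) (A.max'_mem _)
  have hlo' : m ≠ (A.min' hA') % 4 → X.min' hX' + A.min' hA' ∉ X + cl m A := by
    intro h hh
    obtain ⟨x, hx, y, hy, hxy⟩ := Finset.mem_add.1 hh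
    rw [mem_cl] at hy
    have h1 := X.min'_le x hx
    have h2 := A.min'_le y hy.1
    have : y = A.min' hA' := by omega
    rw [← this] at h
    exact h hy.2.symm
  have hhi' : m ≠ (A.max' hA') % 4 → X.max' hX' + A.max' hA' ∉ X + cl m A := by
    intro h hh
    obtain ⟨x, hx, y, hy, hxy⟩ := Finset.mem_add.1 hh
    rw [mem_cl] at hy
    have h1 := X.le_max' x hx
    have h2 := A.le_max' y hy.1
    have : y = A.max' hA' := by omega
    rw [← this] at h
    exact h hy.2.symm
  by_cases h1 : m = (A.min' hA') % 4 <;> by_cases h2 : m = (A.max' hA') % 4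
  · simp only [if_pos h1, if_pos h2]
    exact Finset.card_le_card hsub
  · simp only [if_pos h1, if_neg h2]
    have := Finset.card_le_card (Finset.insert_subset hhi hsub)
    rw [Finset.card_insert_of_notMem (hhi' h2)] at this
    omega
  · simp only [if_neg h1, if_pos h2]
    have := Finset.card_le_card (Finset.insert_subset hlo hsub)
    rw [Finset.card_insert_of_notMem (hlo' h1)] at this
    omega
  · simp only [if_neg h1, if_neg h2]
    have := Finset.card_le_card (Finset.insert_subset hlo (Finset.insert_subset hhi hsub))
    rw [Finset.card_insert_of_notMem, Finset.card_insert_of_notMem (hhi' h2)] at this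
    · omega
    · rw [Finset.mem_insert, not_or]
      refine ⟨?_, hlo' h1⟩
      have : u ≠ A.min' hA' := by
        intro h
        rw [h] at hu'
        exact h1 hu'.2.symm
      omega
lemma n3adj (u v n0 n1 n2 Na Nb Nc Nd : ℕ) (hu : 0 < u) (hv : 0 < v)
    (p0 : 0 < n0) (p1 : 0 < n1) (p2 : 0 < n2)
    (h1 : u + n0 ≤ Na + 1) (h2 : u + n1 ≤ Nb + 1) (h3 : v + n0 ≤ Nb + 1) (h4 : u + n2 ≤ Nc + 1)
    (h5 : v + n1 ≤ Nc + 1) (h6 : v + n2 ≤ Nd + 1) (hM : u + v ≤ n0 ∨ u + v ≤ n1 ∨ u + v ≤ n2) :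
    2 * (u + v) + (n0 + n1 + n2) ≤ (Na + Nb + Nc + Nd) + 2 := by
  rcases Nat.lt_or_ge n1 2 with h | h
  · omega
  · omega

lemma n3opp (u v n0 n1 n2 Na Nb Nc Nd : ℕ) (p1 : 0 < n1) 
    (h2 : u + n1 ≤ Nb + 1) (h5 : v + n1 ≤ Nd + 1) (h6 : u + v + n0 + n2 ≤ Na + Nc + 1) :
    2 * (u + v) + (n0 + n1 + n2) ≤ (Na + Nb + Nc + Nd) + 2 := by
  omega

lemma n3tri (u v w n0 n1 n2 N0 N1 N2 N3 T : ℕ) (hT : T = N0 + N1 + N2 + N3)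
    (hu : 0 < u) (hv : 0 < v) (hw : 0 < w)
    (h02 : v + n2 ≤ N0 + 1) (h01 : w + n1 ≤ N0 + 1)
    (h10 : u + n0 ≤ N1 + 1) (h12 : w + n2 ≤ N1 + 1)
    (h21 : u + n1 ≤ N2 + 1) (h20 : v + n0 ≤ N2 + 1)
    (h32 : u + n2 ≤ N3 + 1) (h31 : v + n1 ≤ N3 + 1) (h30 : w + n0 ≤ N3 + 1)
    (sp : u = 1 → v = 1 → w = 1 → n0 = 3 → n1 = 3 → n2 = 3 → 13 ≤ T)
    (hM : u + v + w ≤ n0 ∨ u + v + w ≤ n1 ∨ u + v + w ≤ n2) :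
    2 * (u + v + w) + (n0 + n1 + n2) ≤ T + 2 := by
  have a1 : u + v + w + 3 * n0 + n2 + v ≤ T + 4 := by omega
  have a2 : u + v + w + 3 * n0 + n1 + w ≤ T + 4 := by omega
  have a3 : u + v + w + 3 * n1 + n0 + u ≤ T + 4 := by omega
  have a4 : u + v + w + 3 * n1 + n2 + w ≤ T + 4 := by omega
  have a5 : u + v + w + 3 * n2 + n1 + u ≤ T + 4 := by omega
  have a6 : u + v + w + 3 * n2 + n0 + v ≤ T + 4 := by omega
  clear h02 h01 h10 h12 h21 h20 h32 h31 h30 hT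
  by_cases hs : u = 1 ∧ v = 1 ∧ w = 1 ∧ n0 = 3 ∧ n1 = 3 ∧ n2 = 3
  · have := sp hs.1 hs.2.1 hs.2.2.1 hs.2.2.2.1 hs.2.2.2.2.1 hs.2.2.2.2.2
    omega
  clear sp
  generalize hX : u + v + w = X at *
  by_cases he : n0 = n1 ∧ n1 = n2
  · have : X < n0 ∨ 2 ≤ u ∨ 2 ≤ v ∨ 2 ≤ w := by omega
    omega
  clear hs
  have m : (n1 ≤ n0 ∧ n2 ≤ n0) ∨ (n0 ≤ n1 ∧ n2 ≤ n1) ∨ (n0 ≤ n2 ∧ n1 ≤ n2) := by omega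
  rcases m with m | m | m
  · have : X ≤ n0 := by omega
    clear hM a3 a4 a5 a6
    rcases Nat.le_total n1 n2 with h | h <;> omega
  · have : X ≤ n1 := by omega
    clear hM a1 a2 a5 a6
    rcases Nat.le_total n0 n2 with h | h <;> omega
  · have : X ≤ n2 := by omega
    clear hM a1 a2 a3 a4
    rcases Nat.le_total n0 n1 with h | h <;> omega

lemma n3full (X n0 n1 n2 T L0 L1 L2 R0 R1 R2 : ℕ)
    (b0 : X + 4 * n0 + L0 + R0 ≤ T + 4) (b1 : X + 4 * n1 + L1 + R1 ≤ T + 4)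
    (b2 : X + 4 * n2 + L2 + R2 ≤ T + 4)
    (l01 : 1 ≤ L0 + L1) (l02 : 1 ≤ L0 + L2) (l12 : 1 ≤ L1 + L2)
    (r01 : 1 ≤ R0 + R1) (r02 : 1 ≤ R0 + R2) (r12 : 1 ≤ R1 + R2)
    (hM : X ≤ n0 ∨ X ≤ n1 ∨ X ≤ n2) :
    2 * X + (n0 + n1 + n2) ≤ T + 2 := by
  have m : ∃ M, X ≤ M ∧ n0 ≤ M ∧ n1 ≤ M ∧ n2 ≤ M ∧ (M = n0 ∨ M = n1 ∨ M = n2) := by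
    refine ⟨max n0 (max n1 n2), ?_⟩
    omega
  obtain ⟨M, hX, m0, m1, m2, hm⟩ := m
  clear hM
  have hX4 : X + 4 * M ≤ T + 4 := by omega
  by_cases hc : X + (n0 + n1 + n2) + 2 ≤ 4 * M
  · omega
  have hs : 3 * M ≤ n0 + n1 + n2 + 1 := by omega
  have : X + 4 * M + 1 ≤ T + 4 := by omega
  by_cases hc : X + (n0 + n1 + n2) + 1 ≤ 4 * M
  · omega
  have e0 : n0 = M := by omega
  have e1 : n1 = M := by omega
  have e2 : n2 = M := by omega
  subst e0
  omega
lemma hN (X A : Finset ℤ) (e m c : ℤ) (h : (e + m) % 4 = c) (h1 : 0 < (cl e X).card)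
    (h2 : 0 < (cl m A).card) :
    (cl e X).card + (cl m A).card ≤ (cl c (X + A)).card + 1 :=
  (add_card h1 h2).trans (Nat.add_le_add_right (cl_add_le X A e m c h) 1)

lemma cl_disj (Z : Finset ℤ) (a b : ℤ) (h : a ≠ b) : Disjoint (cl a Z) (cl b Z) := by
  rw [Finset.disjoint_left]
  intro z h1 h2
  rw [mem_cl] at h1 h2
  exact h (h1.2.symm.trans h2.2)

lemma hP (X A : Finset ℤ) (e e' c c' : ℤ) (hee : e ≠ e') (h : (e + 0) % 4 = c)
    (h' : (e' + 0) % 4 = c')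
    (k : (e + 2) % 4 = c') (k' : (e' + 2) % 4 = c)
    (h1 : 0 < (cl e X).card) (h2 : 0 < (cl 0 A).card) :
    (cl e X).card + (cl e' X).card + (cl 0 A).card + (cl 2 A).card ≤
      (cl c (X + A)).card + (cl c' (X + A)).card + 1 := by
  have hs : (cl e X ∪ cl e' X) + (cl 0 A ∪ cl 2 A) ⊆ cl c (X + A) ∪ cl c' (X + A) := by
    rw [Finset.union_add, Finset.add_union, Finset.add_union]
    have a1 := cl_add X A e 0 c h
    have a2 := cl_add X A e 2 c' k
    have a3 := cl_add X A e' 0 c' h'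
    have a4 := cl_add X A e' 2 c k'
    refine Finset.union_subset (Finset.union_subset ?_ ?_) (Finset.union_subset ?_ ?_)
    · exact a1.trans Finset.subset_union_left
    · exact a2.trans Finset.subset_union_right
    · exact a3.trans Finset.subset_union_right
    · exact a4.trans Finset.subset_union_left
  have hc := Finset.card_le_card hs
  have hu := Finset.card_union_le (cl c (X + A)) (cl c' (X + A))
  have d1 := Finset.card_union_of_disjoint (cl_disj X e e' hee)
  have d2 := Finset.card_union_of_disjoint (cl_disj A 0 2 (by norm_num))
  have := add_card (X := cl e X ∪ cl e' X) (Y := cl 0 A ∪ cl 2 A) (by omega) (by omega)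
  omega

lemma min_eq (Z P Q : Finset ℤ) (x y : ℤ) (hZ : Z.card ≤ 3) (hPc : P.card = 3) (hQc : Q.card = 3)
    (hP : P.Nonempty) (hQ : Q.Nonempty)
    (h1 : ∀ p ∈ P, x + p ∈ Z) (h2 : ∀ q ∈ Q, y + q ∈ Z) :
    x + P.min' hP ≤ y + Q.min' hQ := by
  have hs : P.image (fun p => x + p) ⊆ Z := by
    intro z hz
    obtain ⟨p, hp, rfl⟩ := Finset.mem_image.1 hz
    exact h1 p hp
  have hc : (P.image (fun p => x + p)).card = 3 := by
    rw [Finset.card_image_of_injective _ (add_right_injective x), hPc]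
  have heq := Finset.eq_of_subset_of_card_le hs (by omega)
  have hm := h2 _ (Q.min'_mem hQ)
  rw [← heq] at hm
  obtain ⟨p, hp, hpp⟩ := Finset.mem_image.1 hm
  have := P.min'_le p hp
  omega

lemma sp333 (X A : Finset ℤ) (e e' c1 c3 d : ℤ) (n0 : (cl 0 A).card = 3)
    (n2 : (cl 2 A).card = 3) (h1 : (e + 0) % 4 = c1) (h1' : (e' + 2) % 4 = c1)
    (h3 : (e + 2) % 4 = c3) (h3' : (e' + 0) % 4 = c3)
    (pe : 0 < (cl e X).card) (pe' : 0 < (cl e' X).card)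
    (hd : 3 ≤ (cl d (X + A)).card) (d' : ℤ) (hd' : 3 ≤ (cl d' (X + A)).card)
    (hT : (X + A).card = (cl c1 (X + A)).card + (cl c3 (X + A)).card + (cl d (X + A)).card +
      (cl d' (X + A)).card) : 13 ≤ (X + A).card := by
  by_contra hcon
  have k1 := hN X A e 0 c1 h1 pe (by omega)
  have k3 := hN X A e 2 c3 h3 pe (by omega)
  obtain ⟨x, hx⟩ := Finset.card_pos.1 pe
  obtain ⟨y, hy⟩ := Finset.card_pos.1 pe'
  have q0 : (cl 0 A).Nonempty := Finset.card_pos.1 (by omega)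
  have q2 : (cl 2 A).Nonempty := Finset.card_pos.1 (by omega)
  have s1 : ∀ p ∈ cl 0 A, x + p ∈ cl c1 (X + A) := fun p hp =>
    cl_add X A e 0 c1 h1 (Finset.add_mem_add hx hp)
  have s2 : ∀ p ∈ cl 2 A, y + p ∈ cl c1 (X + A) := fun p hp =>
    cl_add X A e' 2 c1 h1' (Finset.add_mem_add hy hp)
  have s3 : ∀ p ∈ cl 2 A, x + p ∈ cl c3 (X + A) := fun p hp =>
    cl_add X A e 2 c3 h3 (Finset.add_mem_add hx hp)
  have s4 : ∀ p ∈ cl 0 A, y + p ∈ cl c3 (X + A) := fun p hp =>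
    cl_add X A e' 0 c3 h3' (Finset.add_mem_add hy hp)
  have m1 := min_eq _ _ _ x y (by omega) n0 n2 q0 q2 s1 s2
  have m2 := min_eq _ _ _ y x (by omega) n2 n0 q2 q0 s2 s1
  have m3 := min_eq _ _ _ x y (by omega) n2 n0 q2 q0 s3 s4
  have m4 := min_eq _ _ _ y x (by omega) n0 n2 q0 q2 s4 s3
  have r0 := (mem_cl.1 ((cl 0 A).min'_mem q0)).2
  have r2 := (mem_cl.1 ((cl 2 A).min'_mem q2)).2
  omega

lemma W_full (X A : Finset ℤ) (m : ℤ) (hm : 0 < (cl m A).card)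
    (e0 : 0 < (cl 0 X).card) (e1 : 0 < (cl 1 X).card) (e2 : 0 < (cl 2 X).card)
    (e3 : 0 < (cl 3 X).card) : X.card + 4 * (cl m A).card ≤ (X + cl m A).card + 4 := by
  have := W_split X A m
  have := card_split X
  have := add_card e0 hm
  have := add_card e1 hm
  have := add_card e2 hm
  have := add_card e3 hm
  omega

lemma J3 (X A : Finset ℤ) (hX : 0 < X.card) (p0 : 0 < (cl 0 A).card) (p1 : 0 < (cl 1 A).card)
    (p2 : 0 < (cl 2 A).card)
    (hM : X.card ≤ (cl 0 A).card ∨ X.card ≤ (cl 1 A).card ∨ X.card ≤ (cl 2 A).card) :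
    2 * X.card + ((cl 0 A).card + (cl 1 A).card + (cl 2 A).card) ≤ (X + A).card + 2 := by
  have hXs := card_split X
  have hT := card_split (X + A)
  have tri (e1 e2 e3 c0 c1 c2 c3 : ℤ) (i1 : (e1 + 0) % 4 = c1) (i2 : (e2 + 0) % 4 = c2)
      (i3 : (e3 + 0) % 4 = c3) (i0 : (e2 + 2) % 4 = c0) (i11 : (e1 + 1) % 4 = c2)
      (i12 : (e1 + 2) % 4 = c3) (i21 : (e2 + 1) % 4 = c3) (i31 : (e3 + 1) % 4 = c0)
      (i32 : (e3 + 2) % 4 = c1) 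
      (x1 : 0 < (cl e1 X).card) (x2 : 0 < (cl e2 X).card) (x3 : 0 < (cl e3 X).card)
      (hXX : X.card = (cl e1 X).card + (cl e2 X).card + (cl e3 X).card)
      (hTT : (X + A).card = (cl c0 (X + A)).card + (cl c1 (X + A)).card + (cl c2 (X + A)).card +
        (cl c3 (X + A)).card) : 
      2 * X.card + ((cl 0 A).card + (cl 1 A).card + (cl 2 A).card) ≤ (X + A).card + 2 := by
    rw [hXX]
    refine n3tri _ _ _ _ _ _ _ _ _ _ _ hTT x1 x2 x3 (hN X A _ _ _ i0 x2 p2)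
      (hN X A _ _ _ i31 x3 p1) (hN X A _ _ _ i1 x1 p0) (hN X A _ _ _ i32 x3 p2)
      (hN X A _ _ _ i11 x1 p1) (hN X A _ _ _ i2 x2 p0) (hN X A _ _ _ i12 x1 p2)
      (hN X A _ _ _ i21 x2 p1) (hN X A _ _ _ i3 x3 p0) ?_ (by omega)
    intro _ _ _ a0 a1 a2
    have b0 := hN X A _ _ _ i31 x3 p1
    have b2 := hN X A _ _ _ i11 x1 p1
    refine sp333 X A e1 e3 c1 c3 c0 a0 a2 i1 i32 i12 i3 x1 x3 (by omega) c2 (by omega) (by omega)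
  have adj (e1 e2 c0 c1 c2 c3 : ℤ) (i10 : (e1 + 0) % 4 = c0) (i20 : (e2 + 0) % 4 = c1)
      (i11 : (e1 + 1) % 4 = c1) (i12 : (e1 + 2) % 4 = c2) (i21 : (e2 + 1) % 4 = c2)
      (i22 : (e2 + 2) % 4 = c3)
      (x1 : 0 < (cl e1 X).card) (x2 : 0 < (cl e2 X).card) 
      (hXX : X.card = (cl e1 X).card + (cl e2 X).card)
      (hTT : (X + A).card = (cl c0 (X + A)).card + (cl c1 (X + A)).card + (cl c2 (X + A)).card +
        (cl c3 (X + A)).card) : 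
      2 * X.card + ((cl 0 A).card + (cl 1 A).card + (cl 2 A).card) ≤ (X + A).card + 2 := by
    rw [hXX, hTT]
    exact n3adj _ _ _ _ _ _ _ _ _ x1 x2 p0 p1 p2 (hN X A _ _ _ i10 x1 p0) (hN X A _ _ _ i11 x1 p1)
      (hN X A _ _ _ i20 x2 p0) (hN X A _ _ _ i12 x1 p2) (hN X A _ _ _ i21 x2 p1)
      (hN X A _ _ _ i22 x2 p2) (by omega)
  have one (e c0 c1 c2 c3 : ℤ) (i0 : (e + 0) % 4 = c0) (i1 : (e + 1) % 4 = c1)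
      (i2 : (e + 2) % 4 = c2) (x1 : 0 < (cl e X).card) (hXX : X.card = (cl e X).card)
      (hTT : (X + A).card = (cl c0 (X + A)).card + (cl c1 (X + A)).card + (cl c2 (X + A)).card +
        (cl c3 (X + A)).card) : 
      2 * X.card + ((cl 0 A).card + (cl 1 A).card + (cl 2 A).card) ≤ (X + A).card + 2 := by
    have := hN X A _ _ _ i0 x1 p0
    have := hN X A _ _ _ i1 x1 p1
    have := hN X A _ _ _ i2 x1 p2
    omega
  rcases Nat.eq_zero_or_pos (cl 0 X).card with e0 | e0 <;>
  rcases Nat.eq_zero_or_pos (cl 1 X).card with e1 | e1 <;>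
  rcases Nat.eq_zero_or_pos (cl 2 X).card with e2 | e2 <;>
  rcases Nat.eq_zero_or_pos (cl 3 X).card with e3 | e3
  · omega
  · exact one 3 3 0 1 2 rfl rfl rfl e3 (by omega) (by omega)
  · exact one 2 2 3 0 1 rfl rfl rfl e2 (by omega) (by omega)
  · exact adj 2 3 2 3 0 1 rfl rfl rfl rfl rfl rfl e2 e3 (by omega) (by omega)
  · exact one 1 1 2 3 0 rfl rfl rfl e1 (by omega) (by omega)
  · have := hP X A 1 3 1 3 (by norm_num) rfl rfl rfl rfl e1 p0
    have := hN X A 1 1 2 rfl e1 p1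
    have := hN X A 3 1 0 rfl e3 p1
    omega
  · exact adj 1 2 1 2 3 0 rfl rfl rfl rfl rfl rfl e1 e2 (by omega) (by omega)
  · exact tri 1 2 3 0 1 2 3 rfl rfl rfl rfl rfl rfl rfl rfl rfl e1 e2 e3 (by omega) (by omega)
  · exact one 0 0 1 2 3 rfl rfl rfl e0 (by omega) (by omega)
  · exact adj 3 0 3 0 1 2 rfl rfl rfl rfl rfl rfl e3 e0 (by omega) (by omega)
  · have := hP X A 0 2 0 2 (by norm_num) rfl rfl rfl rfl e0 p0
    have := hN X A 0 1 1 rfl e0 p1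
    have := hN X A 2 1 3 rfl e2 p1
    omega
  · exact tri 2 3 0 1 2 3 0 rfl rfl rfl rfl rfl rfl rfl rfl rfl e2 e3 e0 (by omega) (by omega)
  · exact adj 0 1 0 1 2 3 rfl rfl rfl rfl rfl rfl e0 e1 (by omega) (by omega)
  · exact tri 3 0 1 2 3 0 1 rfl rfl rfl rfl rfl rfl rfl rfl rfl e3 e0 e1 (by omega) (by omega)
  · exact tri 0 1 2 3 0 1 2 rfl rfl rfl rfl rfl rfl rfl rfl rfl e0 e1 e2 (by omega) (by omega)
  · have hA := card_split A
    obtain ⟨p, q, hb⟩ := bonus X A hX (by omega)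
    have b0 := hb 0 p0
    have b1 := hb 1 p1
    have b2 := hb 2 p2
    have w0 := W_full X A 0 p0 e0 e1 e2 e3
    have w1 := W_full X A 1 p1 e0 e1 e2 e3
    have w2 := W_full X A 2 p2 e0 e1 e2 e3
    have key (m m' r : ℤ) (h : m ≠ m') :
        1 ≤ (if m = r then 0 else 1) + (if m' = r then 0 else 1 : ℕ) := by
      split_ifs <;> omega
    exact n3full _ _ _ _ _ _ _ _ _ _ _ (by omega) (by omega) (by omega)
      (key 0 1 p (by norm_num)) (key 0 2 p (by norm_num)) (key 1 2 p (by norm_num))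
      (key 0 1 q (by norm_num)) (key 0 2 q (by norm_num)) (key 1 2 q (by norm_num)) hM

lemma core3 (A : Finset ℤ) (p0 : 0 < (cl 0 A).card) (p1 : 0 < (cl 1 A).card)
    (p2 : 0 < (cl 2 A).card) (p3 : (cl 3 A).card = 0) :
    5 * A.card ≤ (S4 A).card + 6 := by
  have hs := S4_split A
  have hA := card_split A
  have c0 := Xi_card 0 A
  have c1 := Xi_card 1 A
  have c2 := Xi_card 2 A
  have := J3 (Xi 0 A) A (by omega) p0 p1 p2 (by omega)
  have := J3 (Xi 1 A) A (by omega) p0 p1 p2 (by omega)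
  have := J3 (Xi 2 A) A (by omega) p0 p1 p2 (by omega)
  omega

lemma core4 (A : Finset ℤ) (p0 : 0 < (cl 0 A).card) (p1 : 0 < (cl 1 A).card)
    (p2 : 0 < (cl 2 A).card) (p3 : 0 < (cl 3 A).card) :
    5 * A.card ≤ (S4 A).card + 4 := by
  have hs := S4_split A
  have hA := card_split A
  have c0 := Xi_card 0 A
  have c1 := Xi_card 1 A
  have c2 := Xi_card 2 A
  have c3 := Xi_card 3 A
  have := add_card (X := Xi 0 A) (Y := A) (by omega) (by omega)
  have := add_card (X := Xi 1 A) (Y := A) (by omega) (by omega)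
  have := add_card (X := Xi 2 A) (Y := A) (by omega) (by omega)
  have := add_card (X := Xi 3 A) (Y := A) (by omega) (by omega)
  omega
/-- numeric consequences when `A` meets exactly the classes 0, 1 mod 4 -/
def Menu (n n0 n1 T W0 W1 ev : ℕ) (Q0 Q1 sp : Prop) : Prop :=
  (n + 3 * n0 + n1 ≤ T + 3 ∧ n + 3 * n1 + n0 ≤ T + 3 ∧ 3 ≤ n) ∨
  (W0 + W1 ≤ T ∧ n + n0 ≤ W0 + 1 ∧ n + n1 ≤ W1 + 1 ∧
    (n = 2 → n0 = 3 → Q0 → 5 ≤ W0) ∧ (n = 2 → n1 = 3 → Q1 → 5 ≤ W1)) ∨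
  (W0 + W1 ≤ T ∧ n + 2 * n0 ≤ W0 + 2 ∧ n + 2 * n1 ≤ W1 + 2 ∧ 2 ≤ n) ∨
  (∃ u v gu0 gu1 gv0 gv1 : ℕ, 0 < u ∧ 0 < v ∧ u + v = n ∧
    (u + n0 ≤ gu0 + 1 ∧ u + n1 ≤ gu1 + 1 ∧ v + n0 ≤ gv0 + 1 ∧ v + n1 ≤ gv1 + 1) ∧
    (gu0 + gu1 + gv1 ≤ T ∧ gu0 + gv0 + gv1 ≤ T ∧ W0 + gv1 ≤ T ∧ W1 + gu0 ≤ T) ∧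
    (n0 = 3 → Q0 → (u = 2 → 5 ≤ gu0) ∧ (v = 2 → 5 ≤ gv0)) ∧
    (n1 = 3 → Q1 → (u = 2 → 5 ≤ gu1) ∧ (v = 2 → 5 ≤ gv1)) ∧
    (n0 = 2 → n1 = 3 → u = 1 → v = 2 → Q1 → sp → 11 ≤ T) ∧
    (ev = u ∨ ev = v))

lemma num2_23 (T0 T1 F0 F1 W01 W10 ev0 ev1 : ℕ) (Q0 Q1 sp : Prop)
    (m0 : Menu 2 2 3 T0 F0 W01 ev0 Q0 Q1 sp) (m1 : Menu 3 2 3 T1 W10 F1 ev1 Q0 Q1 True)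
    (f0 : 4 ≤ F0) (f1 : 8 ≤ F1) (g1 : 9 ≤ F1 ∨ Q1) : 19 ≤ T0 + T1 := by
  rcases g1 with g1 | g1
  · have h0 : 8 ≤ T0 := by
      rcases m0 with h | h | h | ⟨u, v, gu0, gu1, gv0, gv1, h1, h2, h3, h4, h5, -⟩ <;> omega
    have h1 : 11 ≤ T1 := by
      rcases m1 with h | h | h | ⟨u, v, gu0, gu1, gv0, gv1, h1, h2, h3, h4, h5, -⟩ <;> omega
    omega
  · have h0 : 8 ≤ T0 := by
      rcases m0 with h | h | h | ⟨u, v, gu0, gu1, gv0, gv1, h1, h2, h3, h4, h5, -⟩ <;> omega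
    have h1 : 11 ≤ T1 := by
      rcases m1 with h | h | h | ⟨u, v, gu0, gu1, gv0, gv1, h1, h2, h3, h4, h5, h6, h7, h8, -⟩
      · omega
      · omega
      · omega
      · simp only [g1, forall_true_left] at h7 h8
        omega
    omega

lemma num2_33 (T0 T1 F0 F1 W01 W10 ev0 ev1 : ℕ) (Q0 Q1 sp sp' : Prop)
    (m0 : Menu 3 3 3 T0 F0 W01 ev0 Q0 Q1 sp) (m1 : Menu 3 3 3 T1 W10 F1 ev1 Q0 Q1 sp')
    (f0 : 8 ≤ F0) (f1 : 8 ≤ F1) (g0 : 9 ≤ F0 ∨ Q0) (g1 : 9 ≤ F1 ∨ Q1) : 24 ≤ T0 + T1 := by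
  have h0 : 12 ≤ T0 := by
    rcases m0 with h | h | h | ⟨u, v, gu0, gu1, gv0, gv1, h1, h2, h3, h4, h5, h6, h7, -⟩
    · omega
    · omega
    · omega
    · rcases g0 with g | g
      · omega
      · simp only [g, forall_true_left] at h6
        omega
  have h1 : 12 ≤ T1 := by
    rcases m1 with h | h | h | ⟨u, v, gu0, gu1, gv0, gv1, h1, h2, h3, h4, h5, h6, h7, -⟩
    · omega
    · omega
    · omega
    · rcases g1 with g | g
      · omega
      · simp only [g, forall_true_left] at h7
        omega
  omega

/-- the target bound -/
def Bd (n s ev : ℕ) : Prop :=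
  (n = 1 → 1 ≤ s) ∧ (n = 2 → 4 ≤ s) ∧ (n = 3 → 8 ≤ s) ∧ (n = 4 → 12 ≤ s) ∧
  (5 ≤ n → 5 * n ≤ s + 6) ∧ (n = 4 → ev = 1 ∨ ev = 3 → 13 ≤ s)

/-- simplified menu -/
def Menu' (n n0 n1 T W0 W1 ev : ℕ) : Prop :=
  (n + 3 * n0 + n1 ≤ T + 3 ∧ n + 3 * n1 + n0 ≤ T + 3 ∧ 3 ≤ n) ∨
  (W0 + W1 ≤ T ∧ n + n0 ≤ W0 + 1 ∧ n + n1 ≤ W1 + 1) ∨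
  (∃ u v : ℕ, 0 < u ∧ 0 < v ∧ u + v = n ∧
    n + n0 + 2 * n1 + u ≤ T + 3 ∧ n + 2 * n0 + n1 + v ≤ T + 3 ∧ 
    W0 + v + n1 ≤ T + 1 ∧ W1 + u + n0 ≤ T + 1 ∧ (ev = u ∨ ev = v))

lemma Menu.simp' {n n0 n1 T W0 W1 ev : ℕ} {Q0 Q1 sp : Prop} (p0 : 0 < n0) (p1 : 0 < n1)
    (h : Menu n n0 n1 T W0 W1 ev Q0 Q1 sp) :
    Menu' n n0 n1 T W0 W1 ev := by
  rcases h with h | h | h | ⟨u, v, gu0, gu1, gv0, gv1, h1, h2, h3, h4, h5, -, -, -, h6⟩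
  · exact Or.inl h
  · exact Or.inr (Or.inl ⟨h.1, h.2.1, h.2.2.1⟩)
  · exact Or.inr (Or.inl ⟨by omega, by omega, by omega⟩)
  · exact Or.inr (Or.inr ⟨u, v, h1, h2, h3, by omega, by omega, by omega, by omega, h6⟩)

set_option maxHeartbeats 8000000 in
lemma num2_gen (a b T0 T1 F0 F1 W01 W10 ev0 ev1 : ℕ) (pa : 0 < a) (hab : a ≤ b)
    (m0 : Menu' a a b T0 F0 W01 ev0) (m1 : Menu' b a b T1 W10 F1 ev1)
    (b0 : Bd a F0 ev0) (b1 : Bd b F1 ev1) (hs : ¬ (b = 3 ∧ 2 ≤ a)) : Bd (a + b) (T0 + T1) a := by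
  obtain ⟨b01, b02, b03, b04, b05, b06⟩ := b0
  obtain ⟨b11, b12, b13, b14, b15, b16⟩ := b1
  have c0 : (a = 1 ∧ 1 ≤ F0) ∨ (a = 2 ∧ 4 ≤ F0) ∨ (a = 3 ∧ 8 ≤ F0) ∨
    (a = 4 ∧ 12 ≤ F0 ∧ (ev0 = 1 ∨ ev0 = 3 → 13 ≤ F0)) ∨ (5 ≤ a ∧ 5 * a ≤ F0 + 6) := by
    have : a = 1 ∨ a = 2 ∨ a = 3 ∨ a = 4 ∨ 5 ≤ a := by clear * - pa hab; omega
    rcases this with h | h | h | h | h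
    · exact Or.inl ⟨h, b01 h⟩
    · exact Or.inr (Or.inl ⟨h, b02 h⟩)
    · exact Or.inr (Or.inr (Or.inl ⟨h, b03 h⟩))
    · exact Or.inr (Or.inr (Or.inr (Or.inl ⟨h, b04 h, b06 h⟩)))
    · exact Or.inr (Or.inr (Or.inr (Or.inr ⟨h, b05 h⟩)))
  have c1 : (b = 1 ∧ 1 ≤ F1) ∨ (b = 2 ∧ 4 ≤ F1) ∨ (b = 3 ∧ 8 ≤ F1) ∨
    (b = 4 ∧ 12 ≤ F1 ∧ (ev1 = 1 ∨ ev1 = 3 → 13 ≤ F1)) ∨ (5 ≤ b ∧ 5 * b ≤ F1 + 6) := by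
    have : b = 1 ∨ b = 2 ∨ b = 3 ∨ b = 4 ∨ 5 ≤ b := by clear * - pa hab; omega
    rcases this with h | h | h | h | h
    · exact Or.inl ⟨h, b11 h⟩
    · exact Or.inr (Or.inl ⟨h, b12 h⟩)
    · exact Or.inr (Or.inr (Or.inl ⟨h, b13 h⟩))
    · exact Or.inr (Or.inr (Or.inr (Or.inl ⟨h, b14 h, b16 h⟩)))
    · exact Or.inr (Or.inr (Or.inr (Or.inr ⟨h, b15 h⟩)))
  clear b01 b02 b03 b04 b05 b06 b11 b12 b13 b14 b15 b16
  have key : (a + b = 2 → 4 ≤ T0 + T1) ∧ (a + b = 3 → 8 ≤ T0 + T1) ∧ (a + b = 4 → 12 ≤ T0 + T1) ∧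
      (5 ≤ a + b → 5 * (a + b) ≤ T0 + T1 + 6) ∧ (a + b = 4 → a = 1 → 13 ≤ T0 + T1) := by
    rcases m0 with h | h | ⟨u, v, h1, h2, h3, h4, h5, h6, h7, h8⟩ <;>
    rcases m1 with k | k | ⟨u', v', k1, k2, k3, k4, k5, k6, k7, k8⟩ <;>
    rcases c0 with ⟨rfl, c0⟩ | ⟨rfl, c0⟩ | ⟨rfl, c0⟩ | ⟨rfl, c0⟩ | c0 <;>
    rcases c1 with ⟨rfl, c1⟩ | ⟨rfl, c1⟩ | ⟨rfl, c1⟩ | ⟨rfl, c1⟩ | c1 <;> omega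
  unfold Bd
  clear * - key pa hab
  omega
/-- no nontrivial three term progression -/
def NAP (X : Finset ℤ) : Prop := ∀ a ∈ X, ∀ b ∈ X, ∀ c ∈ X, a ≠ c → a + c ≠ 2 * b

lemma ap9 (X : Finset ℤ) : 9 ≤ (S4 X).card ∨ NAP X := by
  by_cases h : NAP X
  · exact Or.inr h
  left
  unfold NAP at h
  push Not at h
  obtain ⟨a, ha, b, hb, c, hc, hac, h⟩ := h
  have hs : ({-5, -4, -3, -1, 0, 1, 3, 4, 5} : Finset ℤ).image (fun k => (c - b) * k + 5 * b) ⊆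
      S4 X := by
    intro z hz
    have mem (p q : ℤ) (hp : p ∈ X) (hq : q ∈ X) (hz : z = p + 4 * q) : z ∈ S4 X := by
      rw [hz]
      exact Finset.add_mem_add hp (Finset.mem_image.2 ⟨q, hq, rfl⟩)
    simp only [Finset.mem_image, Finset.mem_insert, Finset.mem_singleton] at hz
    obtain ⟨k, hk, hz⟩ := hz
    rcases hk with rfl | rfl | rfl | rfl | rfl | rfl | rfl | rfl | rfl
    · exact mem a a ha ha (by omega)
    · exact mem b a hb ha (by omega)
    · exact mem c a hc ha (by omega)
    · exact mem a b ha hb (by omega)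
    · exact mem b b hb hb (by omega)
    · exact mem c b hc hb (by omega)
    · exact mem a c ha hc (by omega)
    · exact mem b c hb hc (by omega)
    · exact mem c c hc hc (by omega)
  have := Finset.card_le_card hs
  rw [card_affine _ _ (by omega)] at this
  exact this

lemma ap_of_small (Y Z : Finset ℤ) (hY : Y.card = 2) (hZ : Z.card = 3) (h : (Y + Z).card ≤ 4) :
    ∃ a ∈ Z, ∃ b ∈ Z, ∃ c ∈ Z, a ≠ c ∧ a + c = 2 * b := by
  have hy : ∃ u v, u < v ∧ u ∈ Y ∧ v ∈ Y := by
    obtain ⟨u, v, huv, rfl⟩ := Finset.card_eq_two.1 hY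
    rcases lt_or_gt_of_ne huv with h | h
    · exact ⟨u, v, h, by simp, by simp⟩
    · exact ⟨v, u, h, by simp, by simp⟩
  have hz : ∃ p q r, p < q ∧ q < r ∧ p ∈ Z ∧ q ∈ Z ∧ r ∈ Z := by
    obtain ⟨p, q, r, h1, h2, h3, rfl⟩ := Finset.card_eq_three.1 hZ
    have : (p < q ∧ q < r) ∨ (p < r ∧ r < q) ∨ (q < p ∧ p < r) ∨ (q < r ∧ r < p) ∨
      (r < p ∧ p < q) ∨ (r < q ∧ q < p) := by omega
    rcases this with h | h | h | h | h | h
    · exact ⟨p, q, r, h.1, h.2, by simp, by simp, by simp⟩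
    · exact ⟨p, r, q, h.1, h.2, by simp, by simp, by simp⟩
    · exact ⟨q, p, r, h.1, h.2, by simp, by simp, by simp⟩
    · exact ⟨q, r, p, h.1, h.2, by simp, by simp, by simp⟩
    · exact ⟨r, p, q, h.1, h.2, by simp, by simp, by simp⟩
    · exact ⟨r, q, p, h.1, h.2, by simp, by simp, by simp⟩
  obtain ⟨u, v, huv, hu, hv⟩ := hy
  obtain ⟨p, q, r, hpq, hqr, hp, hq, hr⟩ := hz
  have hs : ({u + p, u + q, u + r, v + r} : Finset ℤ) ⊆ Y + Z := by
    intro z hz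
    simp only [Finset.mem_insert, Finset.mem_singleton] at hz
    rcases hz with rfl | rfl | rfl | rfl
    · exact Finset.add_mem_add hu hp
    · exact Finset.add_mem_add hu hq
    · exact Finset.add_mem_add hu hr
    · exact Finset.add_mem_add hv hr
  have hc : ({u + p, u + q, u + r, v + r} : Finset ℤ).card = 4 := by
    rw [Finset.card_insert_of_notMem, Finset.card_insert_of_notMem, Finset.card_insert_of_notMem,
      Finset.card_singleton]
    all_goals
      simp only [Finset.mem_insert, Finset.mem_singleton]
      omega
  have heq := Finset.eq_of_subset_of_card_le hs (by omega)
  have k1 : v + p ∈ Y + Z := Finset.add_mem_add hv hp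
  have k2 : v + q ∈ Y + Z := Finset.add_mem_add hv hq
  rw [← heq] at k1 k2
  simp only [Finset.mem_insert, Finset.mem_singleton] at k1 k2
  exact ⟨p, hp, q, hq, r, hr, by omega, by omega⟩

lemma nap5 (Y A : Finset ℤ) (m : ℤ) (hY : Y.card = 2) (hZ : (cl m A).card = 3)
    (hn : NAP (Xi m A)) : 5 ≤ (Y + cl m A).card := by
  by_contra hcon
  obtain ⟨a, ha, b, hb, c, hc, hac, h⟩ := ap_of_small Y (cl m A) hY hZ (by omega)
  have h1 := (mem_cl.1 ha).2
  have h2 := (mem_cl.1 hb).2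
  have h3 := (mem_cl.1 hc).2
  exact hn (a / 4) (Finset.mem_image.2 ⟨a, ha, rfl⟩) (b / 4) (Finset.mem_image.2 ⟨b, hb, rfl⟩)
    (c / 4) (Finset.mem_image.2 ⟨c, hc, rfl⟩) (by omega) (by omega)

lemma spec4 (A : Finset ℤ) (e g : ℤ) (heg : (e + 1) % 4 = g) (hg0 : (g + 0) % 4 = g)
    (n0 : (cl 0 A).card = 2) (n1 : (cl 1 A).card = 3)
    (hu : (cl e (Xi 1 A)).card = 1) (hv : (cl g (Xi 1 A)).card = 2) (hn : NAP (Xi 1 A)) :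
    4 ≤ (cl g (Xi 1 A + A)).card := by
  by_contra hcon
  have hXc := Xi_card 1 A
  have hegne : e ≠ g := by
    intro h
    rw [h] at hu
    omega
  obtain ⟨p, hp⟩ := Finset.card_eq_one.1 hu
  obtain ⟨q, r, hqr, hqr'⟩ := Finset.card_eq_two.1 hv
  obtain ⟨s, t, hst, hst'⟩ := Finset.card_eq_two.1 n0
  have hX : cl e (Xi 1 A) ∪ cl g (Xi 1 A) = Xi 1 A := by
    apply Finset.eq_of_subset_of_card_le (Finset.union_subset (cl_sub _ _) (cl_sub _ _))
    rw [Finset.card_union_of_disjoint (cl_disj _ _ _ hegne)]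
    omega
  have hX' : Xi 1 A = {p, q, r} := by
    rw [← hX, hp, hqr']
    rfl
  have mp : p ∈ cl e (Xi 1 A) := by rw [hp]; simp
  have mq : q ∈ cl g (Xi 1 A) := by rw [hqr']; simp
  have mr : r ∈ cl g (Xi 1 A) := by rw [hqr']; simp
  have ms : s ∈ cl 0 A := by rw [hst']; simp
  have mt : t ∈ cl 0 A := by rw [hst']; simp
  have hs : (cl 1 A).image (fun x => p + x) ⊆ cl g (Xi 1 A + A) := by
    intro z hz
    obtain ⟨x, hx, rfl⟩ := Finset.mem_image.1 hz
    exact cl_add _ _ e 1 g heg (Finset.add_mem_add mp hx)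
  have hc : ((cl 1 A).image (fun x => p + x)).card = 3 := by
    rw [Finset.card_image_of_injective _ (add_right_injective p), n1]
  have heq := Finset.eq_of_subset_of_card_le hs (by omega)
  have key (y w : ℤ) (hy : y ∈ cl g (Xi 1 A)) (hw : w ∈ cl 0 A) :
      y + w = p + (4 * p + 1) ∨ y + w = p + (4 * q + 1) ∨ y + w = p + (4 * r + 1) := by
    have h1 : y + w ∈ cl g (Xi 1 A + A) := cl_add _ _ g 0 g hg0 (Finset.add_mem_add hy hw)
    rw [← heq, ← Xi_image, hX'] at h1
    simp only [Finset.mem_image, Finset.mem_insert, Finset.mem_singleton] at h1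
    obtain ⟨a, ⟨b, hb, rfl⟩, h1⟩ := h1
    rcases hb with rfl | rfl | rfl <;> omega
  have k1 := key q s mq ms
  have k2 := key q t mq mt
  have k3 := key r s mr ms
  have k4 := key r t mr mt
  have hpX : p ∈ Xi 1 A := cl_sub _ _ mp
  have hqX : q ∈ Xi 1 A := cl_sub _ _ mq
  have hrX : r ∈ Xi 1 A := cl_sub _ _ mr
  have hpe := (mem_cl.1 mp).2
  have hqe := (mem_cl.1 mq).2
  have hre := (mem_cl.1 mr).2
  have a1 := hn p hpX q hqX r hrX (by omega)
  have a2 := hn p hpX r hrX q hqX (by omega)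
  have a3 := hn q hqX p hpX r hrX (by omega)
  clear heq hc hs hX hX' key hcon
  rcases k1 with k1 | k1 | k1 <;> rcases k4 with k4 | k4 | k4 <;>
    rcases k2 with k2 | k2 | k2 <;> omega

/-- number of even elements -/
def ev (X : Finset ℤ) : ℕ := (cl 0 X).card + (cl 2 X).card

lemma G_zero (X A : Finset ℤ) (e m : ℤ) (h : (cl e X).card = 0) :
    (cl e X + cl m A).card = 0 := by
  rw [Finset.card_eq_zero] at *
  rw [h, Finset.empty_add]

lemma J2 (X A : Finset ℤ) (hX : 0 < X.card) (p0 : 0 < (cl 0 A).card) (p1 : 0 < (cl 1 A).card) :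
    Menu X.card (cl 0 A).card (cl 1 A).card (X + A).card (X + cl 0 A).card (X + cl 1 A).card
      (ev X) (NAP (Xi 0 A)) (NAP (Xi 1 A)) (X = Xi 1 A) := by
  have hXs := card_split X
  have hT := card_split (X + A)
  have hW0 := W_split X A 0
  have hW1 := W_split X A 1
  have tri (e1 e2 e3 c0 c1 c2 c3 : ℤ) (i10 : (e1 + 0) % 4 = c1) (i20 : (e2 + 0) % 4 = c2)
      (i30 : (e3 + 0) % 4 = c3) (i11 : (e1 + 1) % 4 = c2)
      (i21 : (e2 + 1) % 4 = c3) (i31 : (e3 + 1) % 4 = c0)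
      (x1 : 0 < (cl e1 X).card) (x2 : 0 < (cl e2 X).card) (x3 : 0 < (cl e3 X).card)
      (hXX : X.card = (cl e1 X).card + (cl e2 X).card + (cl e3 X).card)
      (hTT : (X + A).card = (cl c0 (X + A)).card + (cl c1 (X + A)).card + (cl c2 (X + A)).card +
        (cl c3 (X + A)).card) : 
      Menu X.card (cl 0 A).card (cl 1 A).card (X + A).card (X + cl 0 A).card (X + cl 1 A).card
      (ev X) (NAP (Xi 0 A)) (NAP (Xi 1 A)) (X = Xi 1 A) := by
    have := hN X A _ _ _ i10 x1 p0
    have := hN X A _ _ _ i20 x2 p0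
    have := hN X A _ _ _ i30 x3 p0
    have := hN X A _ _ _ i11 x1 p1
    have := hN X A _ _ _ i21 x2 p1
    have := hN X A _ _ _ i31 x3 p1
    clear hXs hT hW0 hW1
    exact Or.inl ⟨by omega, by omega, by omega⟩
  have adj (e1 e2 c0 c1 c2 c3 : ℤ) (i10 : (e1 + 0) % 4 = c0) (i20 : (e2 + 0) % 4 = c1)
      (i11 : (e1 + 1) % 4 = c1) (i21 : (e2 + 1) % 4 = c2) (hc1 : (e1 + 1) % 4 = e2)
      (x1 : 0 < (cl e1 X).card) (x2 : 0 < (cl e2 X).card) 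
      (hXX : X.card = (cl e1 X).card + (cl e2 X).card)
      (hW0' : (X + cl 0 A).card = (cl e1 X + cl 0 A).card + (cl e2 X + cl 0 A).card)
      (hW1' : (X + cl 1 A).card = (cl e1 X + cl 1 A).card + (cl e2 X + cl 1 A).card)
      (hev : ev X = (cl e1 X).card ∨ ev X = (cl e2 X).card)
      (hTT : (X + A).card = (cl c0 (X + A)).card + (cl c1 (X + A)).card + (cl c2 (X + A)).card +
        (cl c3 (X + A)).card) : 
      Menu X.card (cl 0 A).card (cl 1 A).card (X + A).card (X + cl 0 A).card (X + cl 1 A).card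
      (ev X) (NAP (Xi 0 A)) (NAP (Xi 1 A)) (X = Xi 1 A) := by
    have h1 := cl_add_le X A _ _ _ i10
    have h2 := cl_add_le X A _ _ _ i20
    have h3 := cl_add_le X A _ _ _ i11
    have h4 := cl_add_le X A _ _ _ i21
    refine Or.inr (Or.inr (Or.inr ⟨(cl e1 X).card, (cl e2 X).card, (cl e1 X + cl 0 A).card,
      (cl e1 X + cl 1 A).card, (cl e2 X + cl 0 A).card, (cl e2 X + cl 1 A).card, x1, x2, hXX.symm,
      ⟨add_card x1 p0, add_card x1 p1, add_card x2 p0, add_card x2 p1⟩, ?_, ?_, ?_, ?_, hev⟩))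
    · clear hXs hT hW0 hW1
      refine ⟨by omega, by omega, by omega, by omega⟩
    · intro a b
      exact ⟨fun h => nap5 _ _ _ h a b, fun h => nap5 _ _ _ h a b⟩
    · intro a b
      exact ⟨fun h => nap5 _ _ _ h a b, fun h => nap5 _ _ _ h a b⟩
    · intro a b c d q hs
      have k1 := nap5 _ _ 1 d b q
      have k0 := add_card x1 p0
      have hc1' : e2 = c1 := hc1.symm.trans i11
      have k2 : 4 ≤ (cl c1 (X + A)).card := by
        subst hc1'
        subst hs
        exact spec4 A e1 e2 i11 i20 a b c d q
      clear hXs hT hW0 hW1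
      omega
  have one (e c0 c1 c2 c3 : ℤ) (i0 : (e + 0) % 4 = c0) (i1 : (e + 1) % 4 = c1)
      (x1 : 0 < (cl e X).card) (hXX : X.card = (cl e X).card)
      (hW0' : (X + cl 0 A).card = (cl e X + cl 0 A).card)
      (hW1' : (X + cl 1 A).card = (cl e X + cl 1 A).card)
      (hTT : (X + A).card = (cl c0 (X + A)).card + (cl c1 (X + A)).card + (cl c2 (X + A)).card +
        (cl c3 (X + A)).card) : 
      Menu X.card (cl 0 A).card (cl 1 A).card (X + A).card (X + cl 0 A).card (X + cl 1 A).card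
      (ev X) (NAP (Xi 0 A)) (NAP (Xi 1 A)) (X = Xi 1 A) := by
    have h1 := cl_add_le X A _ _ _ i0
    have h2 := cl_add_le X A _ _ _ i1
    refine Or.inr (Or.inl ⟨by omega, add_card hX p0, add_card hX p1, ?_, ?_⟩)
    · intro a b c
      exact nap5 _ _ _ a b c
    · intro a b c
      exact nap5 _ _ _ a b c
  have opp (e1 e2 c0 c1 c2 c3 : ℤ) (i10 : (e1 + 0) % 4 = c0) (i20 : (e2 + 0) % 4 = c2)
      (i11 : (e1 + 1) % 4 = c1) (i21 : (e2 + 1) % 4 = c3)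
      (x1 : 0 < (cl e1 X).card) (x2 : 0 < (cl e2 X).card) 
      (hXX : X.card = (cl e1 X).card + (cl e2 X).card)
      (hW0' : (X + cl 0 A).card = (cl e1 X + cl 0 A).card + (cl e2 X + cl 0 A).card)
      (hW1' : (X + cl 1 A).card = (cl e1 X + cl 1 A).card + (cl e2 X + cl 1 A).card)
      (hTT : (X + A).card = (cl c0 (X + A)).card + (cl c1 (X + A)).card + (cl c2 (X + A)).card +
        (cl c3 (X + A)).card) : 
      Menu X.card (cl 0 A).card (cl 1 A).card (X + A).card (X + cl 0 A).card (X + cl 1 A).card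
      (ev X) (NAP (Xi 0 A)) (NAP (Xi 1 A)) (X = Xi 1 A) := by
    have h1 := cl_add_le X A _ _ _ i10
    have h2 := cl_add_le X A _ _ _ i20
    have h3 := cl_add_le X A _ _ _ i11
    have h4 := cl_add_le X A _ _ _ i21
    have := add_card x1 p0
    have := add_card x1 p1
    have := add_card x2 p0
    have := add_card x2 p1
    clear hXs hT hW0 hW1
    exact Or.inr (Or.inr (Or.inl ⟨by omega, by omega, by omega, by omega⟩))
  have z (e m : ℤ) := G_zero X A e m
  have z00 := z 0 0
  have z10 := z 1 0
  have z20 := z 2 0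
  have z30 := z 3 0
  have z01 := z 0 1
  have z11 := z 1 1
  have z21 := z 2 1
  have z31 := z 3 1
  have hev : ev X = (cl 0 X).card + (cl 2 X).card := rfl
  rcases Nat.eq_zero_or_pos (cl 0 X).card with e0 | e0 <;>
  rcases Nat.eq_zero_or_pos (cl 1 X).card with e1 | e1 <;>
  rcases Nat.eq_zero_or_pos (cl 2 X).card with e2 | e2 <;>
  rcases Nat.eq_zero_or_pos (cl 3 X).card with e3 | e3
  · omega
  · exact one 3 3 0 1 2 rfl rfl e3 (by omega) (by omega) (by omega) (by omega)
  · exact one 2 2 3 0 1 rfl rfl e2 (by omega) (by omega) (by omega) (by omega)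
  · exact adj 2 3 2 3 0 1 rfl rfl rfl rfl rfl e2 e3 (by omega) (by omega) (by omega) (by omega)
      (by omega)
  · exact one 1 1 2 3 0 rfl rfl e1 (by omega) (by omega) (by omega) (by omega)
  · exact opp 1 3 1 2 3 0 rfl rfl rfl rfl e1 e3 (by omega) (by omega) (by omega) (by omega)
  · exact adj 1 2 1 2 3 0 rfl rfl rfl rfl rfl e1 e2 (by omega) (by omega) (by omega) (by omega)
      (by omega)
  · exact tri 1 2 3 0 1 2 3 rfl rfl rfl rfl rfl rfl e1 e2 e3 (by omega) (by omega)
  · exact one 0 0 1 2 3 rfl rfl e0 (by omega) (by omega) (by omega) (by omega)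
  · exact adj 3 0 3 0 1 2 rfl rfl rfl rfl rfl e3 e0 (by omega) (by omega) (by omega) (by omega)
      (by omega)
  · exact opp 0 2 0 1 2 3 rfl rfl rfl rfl e0 e2 (by omega) (by omega) (by omega) (by omega)
  · exact tri 2 3 0 1 2 3 0 rfl rfl rfl rfl rfl rfl e2 e3 e0 (by omega) (by omega)
  · exact adj 0 1 0 1 2 3 rfl rfl rfl rfl rfl e0 e1 (by omega) (by omega) (by omega) (by omega)
      (by omega)
  · exact tri 3 0 1 2 3 0 1 rfl rfl rfl rfl rfl rfl e3 e0 e1 (by omega) (by omega)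
  · exact tri 0 1 2 3 0 1 2 rfl rfl rfl rfl rfl rfl e0 e1 e2 (by omega) (by omega)
  · have hA := card_split A
    obtain ⟨p, q, hb⟩ := bonus X A hX (by omega)
    have b0 := hb 0 p0
    have b1 := hb 1 p1
    have w0 := W_full X A 0 p0 e0 e1 e2 e3
    have w1 := W_full X A 1 p1 e0 e1 e2 e3
    have key (m m' r : ℤ) (h : m ≠ m') :
        1 ≤ (if m = r then 0 else 1) + (if m' = r then 0 else 1 : ℕ) := by
      split_ifs <;> omega
    have k := key 0 1 p (by norm_num)
    clear hT hW0 hW1 z00 z10 z20 z30 z01 z11 z21 z31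
    generalize (if (0:ℤ) = p then 0 else 1 : ℕ) = L0 at *
    generalize (if (1:ℤ) = p then 0 else 1 : ℕ) = L1 at *
    exact Or.inl ⟨by omega, by omega, by omega⟩

lemma empty_sum (i : ℤ) (A : Finset ℤ) (h : (cl i A).card = 0) : (Xi i A + A).card = 0 := by
  rw [← Xi_card, Finset.card_eq_zero] at h
  rw [h, Finset.empty_add, Finset.card_empty]

lemma core2le (A : Finset ℤ) (p0 : 0 < (cl 0 A).card) (p1 : 0 < (cl 1 A).card)
    (p2 : (cl 2 A).card = 0) (p3 : (cl 3 A).card = 0) (hle : (cl 0 A).card ≤ (cl 1 A).card)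
    (ih : ∀ B : Finset ℤ, B.card < A.card → 0 < B.card → Bd B.card (S4 B).card (ev B)) :
    Bd A.card (S4 A).card (ev A) := by
  have hs := card_split A
  have hS := S4_split A
  rw [empty_sum 2 A p2, empty_sum 3 A p3] at hS
  have c0 := Xi_card 0 A
  have c1 := Xi_card 1 A
  have m0 := J2 (Xi 0 A) A (by omega) p0 p1
  have m1 := J2 (Xi 1 A) A (by omega) p0 p1
  have b0 := ih (Xi 0 A) (by omega) (by omega)
  have b1 := ih (Xi 1 A) (by omega) (by omega)
  have g0 := ap9 (Xi 0 A)
  have g1 := ap9 (Xi 1 A)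
  rw [F_eq, c0] at m0
  rw [F_eq, c1] at m1
  rw [c0] at b0
  rw [c1] at b1
  have he : ev A = (cl 0 A).card := by simp [ev, p2]
  have hn : A.card = (cl 0 A).card + (cl 1 A).card := by omega
  have hT : (S4 A).card = (Xi 0 A + A).card + (Xi 1 A + A).card := by omega
  rw [he, hn, hT]
  by_cases hsp : (cl 1 A).card = 3 ∧ 2 ≤ (cl 0 A).card
  · obtain ⟨h3, h2⟩ := hsp
    have : (cl 0 A).card = 2 ∨ (cl 0 A).card = 3 := by omega
    rcases this with h | h
    · rw [h, h3] at m0 m1 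
      have e : (Xi 1 A = Xi 1 A) = True := by simp
      rw [e] at m1
      have := num2_23 _ _ _ _ _ _ _ _ _ _ _ m0 m1 (b0.2.1 h) (b1.2.2.1 h3) g1
      unfold Bd
      omega
    · rw [h, h3] at m0 m1 
      have := num2_33 _ _ _ _ _ _ _ _ _ _ _ _ m0 m1 (b0.2.2.1 h) (b1.2.2.1 h3) g0 g1
      unfold Bd
      omega
  · exact num2_gen _ _ _ _ _ _ _ _ _ _ p0 hle (Menu.simp' p0 p1 m0) (Menu.simp' p0 p1 m1) b0 b1 hsp

lemma cl_image (k t c d : ℤ) (hk : k ≠ 0) (A : Finset ℤ)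
    (h : ∀ x : ℤ, (k * x + t) % 4 = c ↔ x % 4 = d) :
    (cl c (A.image (fun x => k * x + t))).card = (cl d A).card := by
  have : cl c (A.image (fun x => k * x + t)) = (cl d A).image (fun x => k * x + t) := by
    ext z
    simp only [mem_cl, Finset.mem_image]
    constructor
    · rintro ⟨⟨x, hx, rfl⟩, hz⟩
      exact ⟨x, ⟨hx, (h x).1 hz⟩, rfl⟩
    · rintro ⟨x, ⟨hx, hz⟩, rfl⟩
      exact ⟨⟨x, hx, rfl⟩, (h x).2 hz⟩
  rw [this, card_affine k t hk]

lemma core2 (A : Finset ℤ) (p0 : 0 < (cl 0 A).card) (p1 : 0 < (cl 1 A).card)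
    (p2 : (cl 2 A).card = 0) (p3 : (cl 3 A).card = 0)
    (ih : ∀ B : Finset ℤ, B.card < A.card → 0 < B.card → Bd B.card (S4 B).card (ev B)) :
    Bd A.card (S4 A).card (ev A) := by
  rcases le_total (cl 0 A).card (cl 1 A).card with h | h
  · exact core2le A p0 p1 p2 p3 h ih
  · have q0 := cl_image (-1) 1 0 1 (by norm_num) A (by intro x; omega)
    have q1 := cl_image (-1) 1 1 0 (by norm_num) A (by intro x; omega)
    have q2 := cl_image (-1) 1 2 3 (by norm_num) A (by intro x; omega)
    have q3 := cl_image (-1) 1 3 2 (by norm_num) A (by intro x; omega)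
    have qc := card_affine (-1) 1 (by norm_num) A
    have qs := affine (-1) 1 (by norm_num) A
    have hs := card_split A
    generalize A.image (fun x => (-1) * x + 1) = B at *
    have := core2le B (by omega) (by omega) (by omega) (by omega) (by omega) (by rwa [qc])
    simp only [Bd, ev] at this ⊢
    rw [qc, qs] at this
    omega

lemma fromStart (A : Finset ℤ) (t i j k l : ℤ)
    (hi : ∀ x : ℤ, (1 * x + t) % 4 = 0 ↔ x % 4 = i) (hj : ∀ x : ℤ, (1 * x + t) % 4 = 1 ↔ x % 4 = j)
    (hk : ∀ x : ℤ, (1 * x + t) % 4 = 2 ↔ x % 4 = k) (hl : ∀ x : ℤ, (1 * x + t) % 4 = 3 ↔ x % 4 = l)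
    (pi : 0 < (cl i A).card) (pj : 0 < (cl j A).card)
    (pkl : (cl l A).card = 0 ∨ 0 < (cl k A).card)
    (hev : ev A = (cl i A).card + (cl k A).card ∨ ev A = (cl j A).card + (cl l A).card)
    (ih : ∀ B : Finset ℤ, B.card < A.card → 0 < B.card → Bd B.card (S4 B).card (ev B)) :
    Bd A.card (S4 A).card (ev A) := by
  have q0 := cl_image 1 t 0 i (by norm_num) A hi
  have q1 := cl_image 1 t 1 j (by norm_num) A hj
  have q2 := cl_image 1 t 2 k (by norm_num) A hk
  have q3 := cl_image 1 t 3 l (by norm_num) A hl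
  have qc := card_affine 1 t (by norm_num) A
  have qs := affine 1 t (by norm_num) A
  generalize A.image (fun x => 1 * x + t) = B at *
  have hs := card_split B
  rcases Nat.eq_zero_or_pos (cl k A).card with hk0 | hk0
  · have := core2 B (by omega) (by omega) (by omega) (by omega) (by rwa [qc])
    simp only [Bd] at this ⊢
    have e : ev B = (cl 0 B).card + (cl 2 B).card := rfl
    rw [qc, qs] at this
    omega
  · rcases Nat.eq_zero_or_pos (cl l A).card with hl0 | hl0
    · have := core3 B (by omega) (by omega) (by omega) (by omega)
      simp only [Bd]
      omega
    · have := core4 B (by omega) (by omega) (by omega) (by omega)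
      simp only [Bd]
      omega

lemma both (A : Finset ℤ) (he : 0 < (cl 0 A).card + (cl 2 A).card)
    (ho : 0 < (cl 1 A).card + (cl 3 A).card)
    (ih : ∀ B : Finset ℤ, B.card < A.card → 0 < B.card → Bd B.card (S4 B).card (ev B)) :
    Bd A.card (S4 A).card (ev A) := by
  have e : ev A = (cl 0 A).card + (cl 2 A).card := rfl
  have cases4 : (0 < (cl 0 A).card ∧ 0 < (cl 1 A).card ∧ ((cl 3 A).card = 0 ∨ 0 < (cl 2 A).card)) ∨
      (0 < (cl 1 A).card ∧ 0 < (cl 2 A).card ∧ ((cl 0 A).card = 0 ∨ 0 < (cl 3 A).card)) ∨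
      (0 < (cl 2 A).card ∧ 0 < (cl 3 A).card ∧ ((cl 1 A).card = 0 ∨ 0 < (cl 0 A).card)) ∨
      (0 < (cl 3 A).card ∧ 0 < (cl 0 A).card ∧ ((cl 2 A).card = 0 ∨ 0 < (cl 1 A).card)) := by
    omega
  rcases cases4 with h | h | h | h
  · exact fromStart A 0 0 1 2 3 (by intro x; omega) (by intro x; omega) (by intro x; omega)
      (by intro x; omega) h.1 h.2.1 h.2.2 (by omega) ih
  · exact fromStart A 3 1 2 3 0 (by intro x; omega) (by intro x; omega) (by intro x; omega)
      (by intro x; omega) h.1 h.2.1 h.2.2 (by omega) ih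
  · exact fromStart A 2 2 3 0 1 (by intro x; omega) (by intro x; omega) (by intro x; omega)
      (by intro x; omega) h.1 h.2.1 h.2.2 (by omega) ih
  · exact fromStart A 1 3 0 1 2 (by intro x; omega) (by intro x; omega) (by intro x; omega)
      (by intro x; omega) h.1 h.2.1 h.2.2 (by omega) ih

lemma halve (A : Finset ℤ) (r : ℤ) (h : ∀ x ∈ A, x % 2 = r) :
    (A.image (fun x => x / 2)).image (fun x => 2 * x + r) = A := by
  rw [Finset.image_image]
  ext z
  simp only [Finset.mem_image, Function.comp]
  constructor
  · rintro ⟨x, hx, rfl⟩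
    have := h x hx
    have e : 2 * (x / 2) + r = x := by omega
    rwa [e]
  · intro hz
    have := h z hz
    exact ⟨z, hz, by omega⟩

lemma parity_of (A : Finset ℤ) (c : ℤ) (h : (cl c A).card = 0) : ∀ x ∈ A, x % 4 ≠ c := by
  intro x hx hc
  have : x ∈ cl c A := mem_cl.2 ⟨hx, hc⟩
  rw [Finset.card_eq_zero] at h
  rw [h] at this
  exact absurd this (Finset.notMem_empty x)

lemma normalize_parity (m : ℕ) : ∀ A : Finset ℤ, ∀ a ∈ A, ∀ b ∈ A, a < b → (b - a) ≤ m →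
    ∃ B : Finset ℤ, B.card = A.card ∧ (S4 B).card = (S4 A).card ∧
      0 < (cl 0 B).card + (cl 2 B).card ∧ 0 < (cl 1 B).card + (cl 3 B).card := by
  induction m with
  | zero => intro A a _ b _ h1 h2; push_cast at h2; omega
  | succ m ih =>
    intro A a ha b hb hab hm
    push_cast at hm
    by_cases h : 0 < (cl 0 A).card + (cl 2 A).card ∧ 0 < (cl 1 A).card + (cl 3 A).card
    · exact ⟨A, rfl, rfl, h⟩
    · have hr : ∃ r : ℤ, ∀ x ∈ A, x % 2 = r := by
        by_cases h' : (cl 0 A).card = 0 ∧ (cl 2 A).card = 0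
        · refine ⟨1, fun x hx => ?_⟩
          have := parity_of A 0 h'.1 x hx
          have := parity_of A 2 h'.2 x hx
          omega
        · refine ⟨0, fun x hx => ?_⟩
          have := parity_of A 1 (by omega) x hx
          have := parity_of A 3 (by omega) x hx
          omega
      obtain ⟨r, hr⟩ := hr
      have hh := halve A r hr
      have hra := hr a ha
      have hrb := hr b hb
      obtain ⟨B, h1, h2, h3⟩ := ih (A.image (fun x => x / 2)) (a / 2)
        (Finset.mem_image_of_mem _ ha) (b / 2) (Finset.mem_image_of_mem _ hb)
        (by omega) (by omega)
      refine ⟨B, ?_, ?_, h3⟩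
      · rw [h1, ← card_affine 2 r (by norm_num), hh]
      · rw [h2, ← affine 2 r (by norm_num), hh]

lemma mainBd (n : ℕ) : ∀ A : Finset ℤ, A.card = n → 0 < A.card →
    Bd A.card (S4 A).card (ev A) := by
  induction n using Nat.strong_induction_on with
  | _ n ih =>
    intro A hn hA
    have ih' : ∀ B : Finset ℤ, B.card < A.card → 0 < B.card → Bd B.card (S4 B).card (ev B) :=
      fun B hB hB' => ih B.card (by omega) B rfl hB'
    have hs := card_split A
    by_cases hb : 0 < (cl 0 A).card + (cl 2 A).card ∧ 0 < (cl 1 A).card + (cl 3 A).card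
    · exact both A hb.1 hb.2 ih'
    · by_cases h1 : A.card = 1
      · have hne : A.Nonempty := Finset.card_pos.1 hA
        have : 0 < (S4 A).card := Finset.card_pos.2 (hne.add (hne.image _))
        simp only [Bd]
        omega
      · obtain ⟨a, ha, b, hb', hab⟩ := Finset.one_lt_card.1 (by omega : 1 < A.card)
        have : ∃ B : Finset ℤ, B.card = A.card ∧ (S4 B).card = (S4 A).card ∧
            0 < (cl 0 B).card + (cl 2 B).card ∧ 0 < (cl 1 B).card + (cl 3 B).card := by
          rcases lt_or_gt_of_ne hab with h | h
          · exact normalize_parity (b - a).toNat A a ha b hb' h (by omega)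
          · exact normalize_parity (a - b).toNat A b hb' a ha h (by omega)
        obtain ⟨B, e1, e2, e3, e4⟩ := this
        have := both B e3 e4 (by rwa [e1])
        have e : ev A = (cl 0 A).card + (cl 2 A).card := rfl
        rw [e1, e2] at this
        simp only [Bd] at this ⊢
        omega

/-- For any finite set `A` of integers with `|A| ≥ 5`, we have `|A + 4·A| ≥ 5|A| − 6`. -/
theorem stmt_2 (A : Finset ℤ) (hA : 5 ≤ A.card) :
    (5 : ℤ) * A.card - 6 ≤ ((A + A.image (fun b => (4 : ℤ) * b)).card : ℤ) := by
  have h := (mainBd A.card A rfl (by omega)).2.2.2.2.1 hA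
  unfold S4 at h
  omega
end

section
/- Let p be a prime, α a positive integer, and k = p^α. Then for every nonempty finite set A of integers, |A + k·A| ≥ (k+1)|A| − k!. -/
open Finset Pointwise

/-- The elements of `A` in the residue class `j` modulo `k`. -/
def cls (k : ℕ) (A : Finset ℤ) (j : ZMod k) : Finset ℤ := A.filter (fun a => (a : ZMod k) = j)

/-- The set of residue classes modulo `k` met by `A`. -/
def res (k : ℕ) (A : Finset ℤ) : Finset (ZMod k) := A.image (fun a : ℤ => (a : ZMod k))

lemma mem_cls {k : ℕ} {A : Finset ℤ} {j : ZMod k} {a : ℤ} :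
    a ∈ cls k A j ↔ a ∈ A ∧ (a : ZMod k) = j := by simp [cls]

lemma mem_res {k : ℕ} {A : Finset ℤ} {j : ZMod k} :
    j ∈ res k A ↔ ∃ a ∈ A, (a : ZMod k) = j := by simp [res]

lemma sum_cls (k : ℕ) (A : Finset ℤ) : ∑ j ∈ res k A, (cls k A j).card = A.card := by
  rw [Finset.card_eq_sum_card_image (fun a : ℤ => (a : ZMod k)) A]
  rfl

lemma cls_pos {k : ℕ} {A : Finset ℤ} {j : ZMod k} : 0 < (cls k A j).card ↔ j ∈ res k A := by
  rw [Finset.card_pos, mem_res]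
  constructor
  · rintro ⟨a, ha⟩
    exact ⟨a, mem_cls.1 ha⟩
  · rintro ⟨a, ha⟩
    exact ⟨a, mem_cls.2 ha⟩

lemma shift_closed (k : ℕ) [NeZero k] (s : ZMod k) (hs : IsUnit s) (Y : Finset (ZMod k))
    (hY : Y.Nonempty) (h : ∀ y ∈ Y, y + s ∈ Y) : Y = univ := by
  obtain ⟨y, hy⟩ := hY
  obtain ⟨u, rfl⟩ := hs
  have key : ∀ n : ℕ, y + n * (u : ZMod k) ∈ Y := by
    intro n
    induction n with
    | zero => simpa using hy
    | succ n ih =>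
      have := h _ ih
      convert this using 1
      push_cast
      ring
  ext z
  simp only [mem_univ, iff_true]
  have := key ((z - y) * (↑u⁻¹ : ZMod k)).val
  rw [ZMod.natCast_zmod_val, mul_assoc, Units.inv_mul] at this
  simpa using this

/-- Chowla's theorem. -/
lemma chowla (k : ℕ) [NeZero k] (N : ZMod k) : ∀ (n : ℕ) (S X : Finset (ZMod k)), S.card = n →
    X.Nonempty → N ∈ S → (∀ s ∈ S, s ≠ N → IsUnit (s - N)) →
    X + S = univ ∨ X.card + S.card ≤ (X + S).card + 1 := by
  intro n
  induction n using Nat.strong_induction_on with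
  | _ n ih =>
  intro S X hn hX hN hS
  by_cases hu : X + S = univ
  · exact Or.inl hu
  right
  by_cases hS1 : S = {N}
  · subst hS1
    simp
  obtain ⟨s, hs, hsN⟩ : ∃ s ∈ S, s ≠ N := by
    by_contra! hc
    exact hS1 (Finset.eq_singleton_iff_unique_mem.2 ⟨hN, hc⟩)
  obtain ⟨x, hx, hxs⟩ : ∃ x ∈ X, x + (s - N) ∉ X := by
    by_contra! hc
    have := shift_closed k _ (hS s hs hsN) X hX hc
    apply hu
    subst this
    ext z
    simp only [mem_univ, iff_true]
    exact Finset.mem_add.2 ⟨z - s, mem_univ _, s, hs, by ring⟩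
  set S' := S.filter (fun t => x + (t - N) ∈ X) with hS'
  set X' := X ∪ (S.filter (fun t => ¬ x + (t - N) ∈ X)).image (fun t => x + (t - N)) with hX'
  have hsub : X' + S' ⊆ X + S := by
    intro z hz
    obtain ⟨a, ha, b, hb, rfl⟩ := Finset.mem_add.1 hz
    rw [hS', mem_filter] at hb
    rw [hX', mem_union, mem_image] at ha
    rcases ha with ha | ⟨t, ht, rfl⟩
    · exact Finset.add_mem_add ha hb.1
    · exact Finset.mem_add.2 ⟨_, hb.2, t, (mem_filter.1 ht).1, by ring⟩
  have hc1 : X'.card = X.card + (S.filter (fun t => ¬ x + (t - N) ∈ X)).card := by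
    rw [hX', card_union_of_disjoint, card_image_of_injective]
    · intro a b hab
      simpa using hab
    · rw [Finset.disjoint_left]
      rintro a ha hb
      obtain ⟨t, ht, rfl⟩ := mem_image.1 hb
      exact (mem_filter.1 ht).2 ha
  have hc2 := Finset.card_filter_add_card_filter_not (s := S) (fun t => x + (t - N) ∈ X)
  have hlt : S'.card < n := by
    rw [← hn]
    apply Finset.card_lt_card
    refine ⟨filter_subset _ _, fun hh => hxs (mem_filter.1 (hh hs)).2⟩
  have := ih S'.card hlt S' X' rfl (hX.mono subset_union_left)
    (mem_filter.2 ⟨hN, by simpa using hx⟩) (fun t ht => hS t (mem_filter.1 ht).1)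
  rcases this with h | h
  · exact absurd (Finset.univ_subset_iff.1 (h ▸ hsub)) hu
  · have := Finset.card_le_card hsub
    have : S'.card = (S.filter (fun t => x + (t - N) ∈ X)).card := rfl
    omega

/-- Counting: new residue classes contribute on top of the base set `U`. -/
lemma count {ι : Type*} [DecidableEq ι] (k : ℕ) (V U : Finset ℤ) (hU : U ⊆ V) (D : Finset ι)
    (φ : ι → ZMod k) (hφ : ∀ a ∈ D, ∀ b ∈ D, φ a = φ b → a = b) (hnew : ∀ a ∈ D, φ a ∉ res k U)
    (g : ι → ℕ) (hg : ∀ a ∈ D, g a ≤ (cls k V (φ a)).card) :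
    U.card + ∑ a ∈ D, g a ≤ V.card := by
  have h1 : (D.biUnion (fun a => cls k V (φ a))).card = ∑ a ∈ D, (cls k V (φ a)).card := by
    apply card_biUnion
    intro a ha b hb hab
    change Disjoint (cls k V (φ a)) (cls k V (φ b))
    rw [Finset.disjoint_left]
    intro z hz hz'
    exact hab (hφ a ha b hb ((mem_cls.1 hz).2.symm.trans (mem_cls.1 hz').2))
  have h2 : Disjoint U (D.biUnion (fun a => cls k V (φ a))) := by
    rw [Finset.disjoint_left]
    intro z hz hz'
    obtain ⟨a, ha, hz'⟩ := mem_biUnion.1 hz'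
    exact hnew a ha (mem_res.2 ⟨z, hz, (mem_cls.1 hz').2⟩)
  have h3 : U ∪ D.biUnion (fun a => cls k V (φ a)) ⊆ V := by
    apply union_subset hU
    intro z hz
    obtain ⟨a, ha, hz'⟩ := mem_biUnion.1 hz
    exact (mem_cls.1 hz').1
  have h4 := card_le_card h3
  rw [card_union_of_disjoint h2, h1] at h4
  have := sum_le_sum hg
  omega

lemma add_ge (B C : Finset ℤ) (hB : B.Nonempty) (hC : C.Nonempty) :
    B.card + C.card ≤ (B + C).card + 1 := by
  have := cauchy_davenport_add_of_linearOrder_isCancelAdd hB hC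
  omega

/-- If `Z` lies in one class then `|Y + Z| ≥ |Y| + t (|Z| - 1)`. -/
lemma single_class (k : ℕ) (Y Z : Finset ℤ) (hZ : Z.Nonempty) (j : ZMod k)
    (hj : ∀ z ∈ Z, (z : ZMod k) = j) :
    Y.card + (res k Y).card * Z.card ≤ (Y + Z).card + (res k Y).card := by
  have h1 := count k (Y + Z) ∅ (empty_subset _) (res k Y) (fun r => r + j)
    (fun a _ b _ h => by simpa using h) (by simp [res])
    (fun r => (cls k Y r + Z).card) (by
      intro r hr
      apply card_le_card
      intro z hz
      obtain ⟨a, ha, b, hb, rfl⟩ := Finset.mem_add.1 hz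
      rw [mem_cls] at ha ⊢
      refine ⟨Finset.add_mem_add ha.1 hb, ?_⟩
      push_cast
      rw [ha.2, hj b hb])
  have h2 : ∑ r ∈ res k Y, ((cls k Y r).card + Z.card) ≤ ∑ r ∈ res k Y, ((cls k Y r + Z).card + 1) :=
    sum_le_sum (fun r hr => add_ge _ _ (card_pos.1 (cls_pos.2 hr)) hZ)
  rw [sum_add_distrib, sum_add_distrib, sum_cls] at h2
  simp at h1 h2
  omega

lemma res_add (k : ℕ) (X A : Finset ℤ) (j : ZMod k) (z : ZMod k) (hz : z ∈ res k (X + cls k A j)) :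
    ∃ x ∈ res k X, x + j = z := by
  obtain ⟨a, ha, rfl⟩ := mem_res.1 hz
  obtain ⟨x, hx, b, hb, rfl⟩ := Finset.mem_add.1 ha
  refine ⟨x, mem_res.2 ⟨x, hx, rfl⟩, ?_⟩
  push_cast
  rw [(mem_cls.1 hb).2]

lemma cls_add (k : ℕ) (X A : Finset ℤ) (j x : ZMod k) (hx : x ∈ res k X) :
    (cls k A j).card ≤ (cls k (X + A) (x + j)).card := by
  obtain ⟨a, ha, rfl⟩ := mem_res.1 hx
  rw [← card_image_of_injective (cls k A j) (add_right_injective a)]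
  apply card_le_card
  intro z hz
  obtain ⟨b, hb, rfl⟩ := mem_image.1 hz
  rw [mem_cls] at hb ⊢
  refine ⟨Finset.add_mem_add ha hb.1, ?_⟩
  push_cast
  rw [hb.2]

lemma res_card_le (k : ℕ) (X : Finset ℤ) : (res k X).card ≤ X.card := card_image_le

lemma cls_sub (k : ℕ) (A : Finset ℤ) (j : ZMod k) : cls k A j ⊆ A := filter_subset _ _

/-- Pairwise gain. -/
lemma gain_a (k : ℕ) [NeZero k] (X A : Finset ℤ) (i j : ZMod k) (hX : X.Nonempty)
    (hXi : X.card = (cls k A i).card) (hij : IsUnit (j - i)) (m C : ℕ)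
    (hmk : m ≤ k) (hmC : m ≤ C) (hbase : m * X.card ≤ (X + cls k A i).card + C) :
    m * X.card + min X.card (cls k A j).card ≤ (X + A).card + C := by
  by_cases hfull : res k X = univ
  · have h1 := single_class k X (cls k A i) (by rw [← card_pos, ← hXi]; exact card_pos.2 hX) i
      (fun z hz => (mem_cls.1 hz).2)
    have h2 := card_le_card (Finset.add_subset_add_left (s := X) (cls_sub k A i))
    rw [hfull, card_univ, ZMod.card, ← hXi] at h1
    have h3 := card_pos.2 hX
    have h4 : k * 1 + m * X.card ≤ k * X.card + m * 1 := by nlinarith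
    have := min_le_left X.card (cls k A j).card
    omega
  · obtain ⟨x, hx, hxn⟩ : ∃ x ∈ res k X, x + (j - i) ∉ res k X := by
      by_contra! hc
      exact hfull (shift_closed k _ hij _ (hX.image _) hc)
    have h1 := count k (X + A) (X + cls k A i) (Finset.add_subset_add_left (cls_sub k A i))
      ({()} : Finset Unit) (fun _ => x + j) (by simp) (by
        intro _ _ h
        obtain ⟨y, hy, hyx⟩ := res_add _ _ _ _ _ h
        apply hxn
        convert hy using 1
        linear_combination -hyx) (fun _ => (cls k A j).card)
        (fun _ _ => cls_add k X A j x hx)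
    simp at h1
    have := min_le_right X.card (cls k A j).card
    omega

/-- Gain from a whole set `D` of classes. -/
lemma gain_b (k : ℕ) [NeZero k] (X A : Finset ℤ) (N M : ZMod k) (D : Finset (ZMod k))
    (hX : X.Nonempty) (hXi : X.card = (cls k A N).card) (hD : ∀ j ∈ D, IsUnit (j - N))
    (hM : M ∈ D) (hDM : ∀ j ∈ D, (cls k A j).card ≤ (cls k A M).card)
    (hDN : ∀ j ∈ D, X.card ≤ (cls k A j).card) (hDk : 2 * D.card ≤ k) (m C : ℕ)
    (hmk : m ≤ k) (hmC : m ≤ C) (hbase : m * X.card ≤ (X + cls k A N).card + C) :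
    (m + 1) * X.card + ∑ j ∈ D, (cls k A j).card ≤ (X + A).card + C + D.card * X.card := by
  have hT : (res k X).Nonempty := hX.image _
  have hXpos := card_pos.2 hX
  have hch : ∀ D' ⊆ D, N ∉ D' → res k X + insert N D' = univ ∨
      (res k X).card + D'.card ≤ (res k X + insert N D').card := by
    intro D' hD' hN
    have := chowla k N _ (insert N D') (res k X) rfl hT (mem_insert_self _ _) (by
      intro s hs hsN
      rcases mem_insert.1 hs with h | h
      · exact absurd h hsN
      · exact hD s (hD' h))
    rw [card_insert_of_notMem hN] at this
    rcases this with h | h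
    · exact Or.inl h
    · right; omega
  by_cases hk1 : k = 1
  · exfalso
    have := card_pos.2 ⟨M, hM⟩
    omega
  have hND : N ∉ D := by
    intro h
    have h1 := hD N h
    have : Fact (1 < k) := ⟨by have := NeZero.ne k; omega⟩
    rw [sub_self] at h1
    exact not_isUnit_zero h1
  by_cases hcap : (res k X).card + D.card ≤ k
  · have hhall := (Finset.all_card_le_biUnion_card_iff_exists_injective
      (fun j : D => (res k X).image (· + (j : ZMod k)) \ (res k X).image (· + N))).1 (by
      intro s
      set D' : Finset (ZMod k) := s.map (Function.Embedding.subtype _) with hD'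
      have hsub : D' ⊆ D := by
        intro z hz
        obtain ⟨a, _, rfl⟩ := mem_map.1 hz
        exact a.2
      have hcard : D'.card = s.card := card_map _
      have h1 : (res k X).card + s.card ≤ (res k X + insert N D').card := by
        rcases hch D' hsub (fun h => hND (hsub h)) with h | h
        · rw [h, card_univ, ZMod.card]
          have := card_le_card hsub
          omega
        · omega
      have h2 : res k X + insert N D' ⊆ (res k X).image (· + N) ∪ s.biUnion
          (fun j : D => (res k X).image (· + (j : ZMod k)) \ (res k X).image (· + N)) := by
        intro z hz
        by_cases hzN : z ∈ (res k X).image (· + N)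
        · exact mem_union_left _ hzN
        apply mem_union_right
        obtain ⟨a, ha, b, hb, rfl⟩ := Finset.mem_add.1 hz
        rcases mem_insert.1 hb with rfl | hb
        · exact absurd (mem_image_of_mem _ ha) hzN
        · obtain ⟨b, hbs, rfl⟩ := mem_map.1 hb
          exact mem_biUnion.2 ⟨b, hbs, mem_sdiff.2 ⟨mem_image_of_mem (· + (b : ZMod k)) ha, hzN⟩⟩
      have h3 := (card_le_card h2).trans (card_union_le _ _)
      rw [card_image_of_injective _ (add_left_injective N)] at h3
      omega)
    obtain ⟨f, hf, hf'⟩ := hhall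
    have h1 := count k (X + A) (X + cls k A N) (Finset.add_subset_add_left (cls_sub k A N))
      D.attach f (fun a _ b _ h => hf h) (by
        intro a _ h
        obtain ⟨y, hy, hyx⟩ := res_add _ _ _ _ _ h
        exact (mem_sdiff.1 (hf' a)).2 (mem_image.2 ⟨y, hy, hyx⟩))
        (fun a => (cls k A a).card) (by
        intro a _
        obtain ⟨x, hx, hxa⟩ := mem_image.1 (mem_sdiff.1 (hf' a)).1
        rw [← hxa]
        exact cls_add k X A a x hx)
    rw [Finset.sum_attach D (fun a => (cls k A a).card)] at h1
    have h2 : 1 * X.card ≤ D.card * X.card := Nat.mul_le_mul_right _ (card_pos.2 ⟨M, hM⟩)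
    have h3 : (m + 1) * X.card = m * X.card + X.card := by ring
    omega
  · have huniv : res k X + insert N D = univ := by
      rcases hch D Subset.rfl hND with h | h
      · exact h
      · have := card_le_univ (res k X + insert N D)
        rw [ZMod.card] at this
        omega
    have hMne : (cls k A M).Nonempty := card_pos.1 (hXpos.trans_le (hDN M hM))
    have h0 := single_class k X (cls k A M) hMne M (fun z hz => (mem_cls.1 hz).2)
    have h1 := count k (X + A) (X + cls k A M) (Finset.add_subset_add_left (cls_sub k A M))
      (univ \ (res k X).image (· + M)) id (fun a _ b _ h => h) (by
        intro a ha h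
        obtain ⟨y, hy, hyx⟩ := res_add _ _ _ _ _ h
        exact (mem_sdiff.1 ha).2 (mem_image.2 ⟨y, hy, hyx⟩))
        (fun a => X.card) (by
        intro a _
        obtain ⟨x, hx, b, hb, hxb⟩ := Finset.mem_add.1 (huniv ▸ mem_univ a)
        have h2 := cls_add k X A b x hx
        rw [hxb] at h2
        refine le_trans ?_ h2
        rcases mem_insert.1 hb with rfl | hb
        · exact hXi.le
        · exact hDN b hb)
    rw [sum_const, card_sdiff_of_subset (subset_univ _),
      card_image_of_injective _ (add_left_injective M), card_univ, ZMod.card, smul_eq_mul] at h1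
    have htk : (res k X).card ≤ k := by simpa using card_le_univ (res k X)
    have htX := res_card_le k X
    have hsum : ∑ j ∈ D, (cls k A j).card ≤ D.card * (cls k A M).card := by
      simpa using sum_le_sum hDM
    have hXM := hDN M hM
    generalize (cls k A M).card = W at *
    generalize (res k X).card = t at *
    generalize X.card = x at *
    generalize D.card = d at *
    generalize (∑ j ∈ D, (cls k A j).card) = s at *
    obtain ⟨e, rfl⟩ : ∃ e, k = t + e := ⟨k - t, by omega⟩
    obtain ⟨v, rfl⟩ : ∃ v, W = x + v := ⟨W - x, by omega⟩
    obtain ⟨u, rfl⟩ : ∃ u, t = d + u := ⟨t - d, by omega⟩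
    rw [Nat.add_sub_cancel_left] at h1
    have h5 : (m : ℤ) * x + (d + u) ≤ (d + u + e) * x + m := by
      rcases hmk.eq_or_lt with h | h
      · have : (m : ℤ) = d + u + e := by exact_mod_cast h
        nlinarith
      · zify at h htX hXpos
        nlinarith
    zify at *
    nlinarith

/-- The dilate `k·A`. -/
def dil (k : ℕ) (A : Finset ℤ) : Finset ℤ := A.image (fun b => (k : ℤ) * b)

lemma exists_X (k : ℕ) [NeZero k] (A : Finset ℤ) (i : ZMod k) :
    ∃ X : Finset ℤ, cls k A i = X.image (fun x => (k : ℤ) * x + (i.val : ℤ)) := by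
  refine ⟨(cls k A i).image (fun y => (y - (i.val : ℤ)) / k), ?_⟩
  rw [image_image]
  symm
  conv_rhs => rw [← image_id (s := cls k A i)]
  apply image_congr
  intro y hy
  have hy' := (mem_cls.1 (mem_coe.1 hy)).2
  have : ((k : ℕ) : ℤ) ∣ y - (i.val : ℤ) := by
    rw [← ZMod.intCast_zmod_eq_zero_iff_dvd]
    push_cast
    rw [ZMod.natCast_zmod_val, hy', sub_self]
  simp only [Function.comp, id]
  rw [Int.mul_ediv_cancel' this]
  ring

lemma aff_inj (k : ℕ) [NeZero k] (r : ℤ) : Function.Injective (fun x : ℤ => (k : ℤ) * x + r) := by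
  intro a b h
  have : (k : ℤ) ≠ 0 := by exact_mod_cast NeZero.ne k
  exact mul_left_cancel₀ this (add_right_cancel h)

lemma one_class (k : ℕ) (A : Finset ℤ) (hA : A.Nonempty) [NeZero k] :
    ((res k A).card + 1) * A.card ≤ (A + dil k A).card + (res k A).card := by
  have h := single_class k A (dil k A) (hA.image _) 0 (by
    intro z hz
    obtain ⟨b, _, rfl⟩ := mem_image.1 hz
    simp)
  have h2 : (dil k A).card = A.card := by
    have := aff_inj k 0
    simp only [add_zero] at this
    exact card_image_of_injective _ this
  rw [h2] at h
  linarith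

lemma step (k : ℕ) [NeZero k] (hloc : ∀ a b : ZMod k, ¬ IsUnit a → ¬ IsUnit b → ¬ IsUnit (a + b))
    (n : ℕ) (hnk : n + 1 ≤ k)
    (ih : ∀ A : Finset ℤ, A.Nonempty → (n + 1) * A.card ≤ (A + dil k A).card + n.factorial)
    (A : Finset ℤ) (hA : A.Nonempty)
    (hab : ∃ a ∈ A, ∃ b ∈ A, IsUnit ((a : ZMod k) - (b : ZMod k))) :
    (n + 2) * A.card ≤ (A + dil k A).card + (n + 1).factorial := by
  have hApos := card_pos.2 hA
  have hone := one_class k A hA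
  have hfac := Nat.self_le_factorial n
  have hfac1 := Nat.self_le_factorial (n + 1)
  by_cases hc : n + 1 ≤ (res k A).card
  · obtain ⟨e, he⟩ := Nat.exists_eq_add_of_le hc
    rw [he] at hone
    nlinarith
  choose X hXe using exists_X k A
  have hXc : ∀ i, (X i).card = (cls k A i).card := fun i => by
    rw [hXe i, card_image_of_injective _ (aff_inj k _)]
  have hXn : ∀ i ∈ res k A, (X i).Nonempty := fun i hi => by
    rw [← card_pos, hXc]
    exact cls_pos.2 hi
  set C := max (n + 1) n.factorial with hC
  have hbase : ∀ i ∈ res k A, (n + 1) * (X i).card ≤ (X i + cls k A i).card + C := by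
    intro i hi
    have h1 := ih (cls k A i) (card_pos.1 (cls_pos.2 hi))
    have h2 : cls k A i + dil k (cls k A i) ⊆
        (X i + cls k A i).image (fun x => (k : ℤ) * x + (i.val : ℤ)) := by
      intro z hz
      obtain ⟨a, ha, b, hb, rfl⟩ := Finset.mem_add.1 hz
      obtain ⟨b, hb', rfl⟩ := mem_image.1 hb
      rw [hXe i] at ha
      obtain ⟨x, hx, rfl⟩ := mem_image.1 ha
      exact mem_image.2 ⟨x + b, Finset.add_mem_add hx hb', by ring⟩
    have h3 := (card_le_card h2).trans card_image_le
    have h4 : n.factorial ≤ C := le_max_right _ _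
    rw [hXc]
    omega
  have hsum : ∑ i ∈ res k A, (X i + A).card ≤ (A + dil k A).card := by
    have := count k (A + dil k A) ∅ (empty_subset _) (res k A) id (fun a _ b _ h => h)
      (by simp [res]) (fun i => (X i + A).card) (by
        intro i hi
        rw [← card_image_of_injective _ (aff_inj k (i.val : ℤ))]
        apply card_le_card
        intro z hz
        obtain ⟨y, hy, rfl⟩ := mem_image.1 hz
        obtain ⟨x, hx, b, hb, rfl⟩ := Finset.mem_add.1 hy
        rw [mem_cls]
        constructor
        · have h1 : (k : ℤ) * x + (i.val : ℤ) ∈ cls k A i := by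
            rw [hXe i]
            exact mem_image_of_mem (fun x => (k : ℤ) * x + (i.val : ℤ)) hx
          exact Finset.mem_add.2 ⟨_, (mem_cls.1 h1).1, (k : ℤ) * b, mem_image_of_mem _ hb, by ring⟩
        · simp)
    simpa using this
  have hmC : n + 1 ≤ C := le_max_left _ _
  obtain ⟨M, hMS, hM⟩ := exists_max_image (res k A) (fun i => (cls k A i).card) (hA.image _)
  have hneg : ∀ a b : ZMod k, IsUnit (a - b) → IsUnit (b - a) := fun a b h => by
    rw [← neg_sub]; exact h.neg
  have hNex : ((res k A).filter (fun j => IsUnit (j - M))).Nonempty := by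
    obtain ⟨a, ha, b, hb, hu⟩ := hab
    by_contra hcon
    rw [not_nonempty_iff_eq_empty, filter_eq_empty_iff] at hcon
    have h1 := hcon (mem_res.2 ⟨a, ha, rfl⟩)
    have h2 := hcon (mem_res.2 ⟨b, hb, rfl⟩)
    have h3 := hloc _ _ h1 (fun h => h2 (hneg _ _ h))
    apply h3
    convert hu using 1
    ring
  obtain ⟨N, hNS, hN⟩ := exists_max_image _ (fun i => (cls k A i).card) hNex
  obtain ⟨hNS, hNM⟩ := mem_filter.1 hNS
  set D := (res k A).filter (fun j => ¬ IsUnit (j - M) ∧ (cls k A N).card < (cls k A j).card) with hD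
  have hDu : ∀ j ∈ D, IsUnit (j - N) := by
    intro j hj
    by_contra hc
    have h1 : ¬ IsUnit (N - j) := fun h => hc (hneg _ _ h)
    refine hloc _ _ h1 (mem_filter.1 hj).2.1 ?_
    convert hNM using 1
    ring
  have hND : N ∉ D := fun h => (mem_filter.1 h).2.1 hNM
  have hDS : D ⊆ res k A := filter_subset _ _
  have hDk : 2 * D.card ≤ k := by
    have h1 : Disjoint D (D.image (· + 1)) := by
      rw [Finset.disjoint_left]
      intro a ha hb
      obtain ⟨b, hb', rfl⟩ := mem_image.1 hb
      have h1 := (mem_filter.1 ha).2.1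
      have h2 := (mem_filter.1 hb').2.1
      have h3 : ¬ IsUnit (M - b) := fun h => h2 (hneg _ _ h)
      refine hloc _ _ h1 h3 ?_
      convert isUnit_one using 1
      ring
    have h2 := card_le_univ (D ∪ D.image (· + 1))
    rw [card_union_of_disjoint h1, card_image_of_injective _ (add_left_injective 1), ZMod.card] at h2
    omega
  have hga : ∀ i ∈ res k A, ∀ j, IsUnit (j - i) →
      (n + 1) * (cls k A i).card + min (cls k A i).card (cls k A j).card ≤ (X i + A).card + C := by
    intro i hi j hij
    have := gain_a k (X i) A i j (hXn i hi) (hXc i) hij (n + 1) C hnk hmC (hbase i hi)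
    rwa [hXc] at this
  have hgN : (n + 2) * (cls k A N).card + ∑ j ∈ D, (cls k A j).card ≤
      (X N + A).card + C + D.card * (cls k A N).card := by
    rcases D.eq_empty_or_nonempty with hDe | ⟨j, hj⟩
    · rw [hDe]
      have h1 := hga N hNS M (hneg _ _ hNM)
      rw [min_eq_left (hM N hNS)] at h1
      simp
      linarith
    · have hMD : M ∈ D := by
        refine mem_filter.2 ⟨hMS, ?_, ((mem_filter.1 hj).2.2).trans_le (hM j (hDS hj))⟩
        have h1 := (mem_filter.1 hj).2.1
        intro h0
        have hz : IsUnit (0 : ZMod k) := by simpa using h0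
        apply h1
        rw [isUnit_zero_iff] at hz
        have h5 : j - M = 1 := by rw [← mul_one (j - M), ← hz, mul_zero]
        rw [h5]
        exact isUnit_one
      have := gain_b k (X N) A N M D (hXn N hNS) (hXc N) hDu hMD (fun j hj => hM j (hDS hj))
        (fun j hj => by rw [hXc]; exact (mem_filter.1 hj).2.2.le) hDk (n + 1) C hnk hmC
        (hbase N hNS)
      rwa [hXc] at this
  -- sum everything up
  have hterm : ∀ i ∈ res k A, ((n : ℤ) + 2) * (cls k A i).card ≤ (X i + A).card + C
      + (if i ∈ D then ((cls k A i).card : ℤ) - (cls k A N).card else 0)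
      - (if i = N then ∑ j ∈ D, (((cls k A j).card : ℤ) - (cls k A N).card) else 0) := by
    intro i hi
    by_cases hiN : i = N
    · subst hiN
      rw [if_neg hND, if_pos rfl, sum_sub_distrib, sum_const, nsmul_eq_mul]
      zify at hgN
      linarith
    rw [if_neg hiN]
    by_cases hiD : i ∈ D
    · rw [if_pos hiD]
      have h1 := hga i hi N (hneg _ _ (hDu i hiD))
      rw [min_eq_right (mem_filter.1 hiD).2.2.le] at h1
      zify at h1
      linarith
    · rw [if_neg hiD]
      by_cases hiM : IsUnit (i - M)
      · have h1 := hga i hi M (hneg _ _ hiM)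
        rw [min_eq_left (hM i hi)] at h1
        zify at h1
        linarith
      · have h3 : (cls k A i).card ≤ (cls k A N).card := by
          by_contra! h
          exact hiD (mem_filter.2 ⟨hi, hiM, h⟩)
        have h2 : IsUnit (N - i) := by
          by_contra h2
          refine hloc _ _ h2 hiM ?_
          convert hNM using 1
          ring
        have h1 := hga i hi N h2
        rw [min_eq_left h3] at h1
        zify at h1
        linarith
  have htot := sum_le_sum hterm
  rw [sum_sub_distrib, sum_add_distrib, sum_add_distrib, ← mul_sum, sum_ite_eq' , if_pos hNS,
    ← sum_filter, filter_mem_eq_inter, inter_eq_right.2 hDS, sum_const, nsmul_eq_mul] at htot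
  have hcl := sum_cls k A
  zify at hcl hsum
  rw [hcl] at htot
  have hfin : (res k A).card * C ≤ (n + 1).factorial := by
    have h1 : (res k A).card ≤ n := by omega
    rw [Nat.factorial_succ]
    calc (res k A).card * C ≤ n * C := Nat.mul_le_mul_right _ h1
      _ ≤ (n + 1) * n.factorial := by
        rw [hC]
        rcases max_choice (n + 1) n.factorial with h | h <;> rw [h] <;> nlinarith
  zify at hfin
  zify
  linarith

lemma norm_step (p : ℕ) (hp : p.Prime) (k : ℕ) (T : ℕ → ℕ → Prop)
    (hT : ∀ A : Finset ℤ, A.Nonempty → (∃ a ∈ A, ∃ b ∈ A, ¬ (p : ℤ) ∣ a - b) →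
      T A.card (A + dil k A).card) :
    ∀ (n : ℕ) (A : Finset ℤ), 2 ≤ A.card → 0 ∈ A → (∀ a ∈ A, a.natAbs ≤ n) →
      T A.card (A + dil k A).card := by
  intro n
  induction n using Nat.strong_induction_on with
  | _ n ih =>
  intro A hA2 h0 hn
  by_cases hex : ∃ a ∈ A, ∃ b ∈ A, ¬ (p : ℤ) ∣ a - b
  · exact hT A ⟨0, h0⟩ hex
  push Not at hex
  have hdiv : ∀ a ∈ A, (p : ℤ) ∣ a := fun a ha => by simpa using hex a ha 0 h0
  have hp0 : (p : ℤ) ≠ 0 := by exact_mod_cast hp.ne_zero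
  set B := A.image (fun a => a / (p : ℤ)) with hB
  have hAB : A = B.image (fun b => (p : ℤ) * b) := by
    rw [hB, image_image]
    symm
    conv_rhs => rw [← image_id (s := A)]
    apply image_congr
    intro a ha
    exact Int.mul_ediv_cancel' (hdiv a ha)
  have h0B : (0 : ℤ) ∈ B := mem_image.2 ⟨0, h0, by simp⟩
  clear_value B
  have hinj : Function.Injective (fun b : ℤ => (p : ℤ) * b) := mul_right_injective₀ hp0
  have hcA : A.card = B.card := by
    conv_lhs => rw [hAB]
    exact card_image_of_injective _ hinj
  have hcS : (A + dil k A).card = (B + dil k B).card := by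
    have : A + dil k A = (B + dil k B).image (fun b => (p : ℤ) * b) := by
      have h1 : dil k A = (dil k B).image (fun b => (p : ℤ) * b) := by
        conv_lhs => rw [hAB]
        rw [dil, dil, image_image, image_image]
        apply image_congr
        intro x _
        simp only [Function.comp]
        ring
      rw [h1]
      conv_lhs => rw [hAB]
      exact (Finset.image_add (AddMonoidHom.mulLeft (p : ℤ))).symm
    rw [this, card_image_of_injective _ hinj]
  rw [hcA, hcS]
  obtain ⟨a, ha, ha0⟩ : ∃ a ∈ A, a ≠ 0 := by
    obtain ⟨a, ha, h⟩ := exists_mem_ne (by omega : 1 < A.card) 0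
    exact ⟨a, ha, h⟩
  have hnpos : 0 < n := (Int.natAbs_pos.2 ha0).trans_le (hn a ha)
  refine ih (n / p) (Nat.div_lt_self hnpos hp.one_lt) B (by omega)
    h0B ?_
  intro b hb
  have h1 : (p : ℤ) * b ∈ A := by
    rw [hAB]; exact mem_image_of_mem (fun b => (p : ℤ) * b) hb
  have h2 := hn _ h1
  rw [Int.natAbs_mul, Int.natAbs_natCast] at h2
  rw [Nat.le_div_iff_mul_le hp.pos]
  linarith

lemma norm_all (p : ℕ) (hp : p.Prime) (k : ℕ) (T : ℕ → ℕ → Prop)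
    (hT : ∀ A : Finset ℤ, A.Nonempty → (∃ a ∈ A, ∃ b ∈ A, ¬ (p : ℤ) ∣ a - b) →
      T A.card (A + dil k A).card) (A : Finset ℤ) (hA2 : 2 ≤ A.card) :
      T A.card (A + dil k A).card := by
  obtain ⟨a, ha⟩ := card_pos.1 (by omega : 0 < A.card)
  set B := A.image (fun x => x - a) with hB
  have hinj : ∀ c : ℤ, Function.Injective (fun x : ℤ => x - c) := fun c => sub_left_injective
  have h1 : B.card = A.card := card_image_of_injective _ (hinj a)
  have h2 : B + dil k B = (A + dil k A).image (fun x => x - (a + k * a)) := by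
    ext z
    simp only [hB, dil, Finset.mem_add, mem_image]
    constructor
    · rintro ⟨_, ⟨x, hx, rfl⟩, _, ⟨_, ⟨y, hy, rfl⟩, rfl⟩, rfl⟩
      exact ⟨_, ⟨x, hx, _, ⟨y, hy, rfl⟩, rfl⟩, by ring⟩
    · rintro ⟨_, ⟨x, hx, _, ⟨y, hy, rfl⟩, rfl⟩, rfl⟩
      exact ⟨_, ⟨x, hx, rfl⟩, _, ⟨_, ⟨y, hy, rfl⟩, rfl⟩, by ring⟩
  have h3 : (B + dil k B).card = (A + dil k A).card := by
    rw [h2, card_image_of_injective _ (hinj _)]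
  rw [← h1, ← h3]
  exact norm_step p hp k T hT (B.sup Int.natAbs) B (by omega) (mem_image.2 ⟨a, ha, by simp⟩)
    (fun b hb => le_sup (f := Int.natAbs) hb)

lemma main_bound (p : ℕ) (hp : p.Prime) (α : ℕ) (hα : 0 < α) (k : ℕ) (hk : k = p ^ α) :
    ∀ m ≤ k, ∀ A : Finset ℤ, A.Nonempty → (m + 1) * A.card ≤ (A + dil k A).card + m.factorial := by
  have : NeZero k := ⟨by rw [hk]; exact pow_ne_zero _ hp.ne_zero⟩
  have hunit : ∀ a : ℤ, IsUnit (a : ZMod k) ↔ ¬ (p : ℤ) ∣ a := by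
    intro a
    rw [ZMod.coe_int_isUnit_iff_isCoprime, hk]
    push_cast
    rw [IsCoprime.pow_left_iff hα]
    exact (Nat.prime_iff_prime_int.1 hp).coprime_iff_not_dvd
  have hloc : ∀ a b : ZMod k, ¬ IsUnit a → ¬ IsUnit b → ¬ IsUnit (a + b) := by
    intro a b
    obtain ⟨a, rfl⟩ := ZMod.intCast_surjective a
    obtain ⟨b, rfl⟩ := ZMod.intCast_surjective b
    rw [← Int.cast_add, hunit, hunit, hunit]
    push Not
    exact dvd_add
  intro m
  induction m with
  | zero =>
    intro _ A hA
    have := one_class k A hA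
    have h2 : 0 < (res k A).card := card_pos.2 (hA.image _)
    have h3 := card_pos.2 hA
    simp
    nlinarith
  | succ n ih =>
    intro hn A hA
    rcases Nat.lt_or_ge A.card 2 with h | h
    · have h1 : A.card = 1 := by have := card_pos.2 hA; omega
      have h2 : 0 < (A + dil k A).card := card_pos.2 (hA.add (hA.image _))
      have := Nat.self_le_factorial (n + 1)
      rw [h1]
      omega
    · exact norm_all p hp k (fun x y => (n + 1 + 1) * x ≤ y + (n + 1).factorial) (by
        rintro B hB ⟨a, ha, b, hb, hu⟩
        refine step k hloc n hn (ih (by omega)) B hB ⟨a, ha, b, hb, ?_⟩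
        rw [← Int.cast_sub, hunit]
        exact hu) A h

/-- Let `p` be a prime, `α` a positive integer, and `k = p^α`. Then for every nonempty finite
set `A` of integers, `|A + k·A| ≥ (k+1)|A| − k!`. -/
theorem stmt_10 (p : ℕ) (hp : p.Prime) (α : ℕ) (hα : 0 < α) (k : ℕ) (hk : k = p ^ α)
    (A : Finset ℤ) (hA : A.Nonempty) :
    ((k : ℤ) + 1) * A.card - (Nat.factorial k : ℤ) ≤
      ((A + A.image (fun b => (k : ℤ) * b)).card : ℤ) := by
  have h := main_bound p hp α hα k hk k le_rfl A hA
  unfold dil at h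
  zify at h
  linarith
end

section
/- Let A be a finite set of integers. (i) If |A| = 2, then |A + 4·A| = 4. (ii) If |A| = 3, then |A + 4·A| ≥ 8. (iii) If |A| = 4, then |A + 4·A| ≥ 12. -/
open Finset Pointwise

/-- Descent: it suffices to treat sets meeting at least two residue classes mod 4. -/
lemma descent_aux (n m : ℕ) (hn : 2 ≤ n)
    (H : ∀ A : Finset ℤ, A.card = n → (∃ a ∈ A, ∃ b ∈ A, a % 4 ≠ b % 4) →
      m ≤ (A + A.image (fun b => (4 : ℤ) * b)).card) (N : ℕ) :
    ∀ A : Finset ℤ, A.card = n → (∀ a ∈ A, ∀ b ∈ A, a - b ≤ N) →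
      m ≤ (A + A.image (fun b => (4 : ℤ) * b)).card := by
  induction N with
  | zero =>
    intro A hA hd
    have : 1 < A.card := by omega
    obtain ⟨a, ha, b, hb, hab⟩ := Finset.one_lt_card.1 this
    have h1 := hd a ha b hb
    have h2 := hd b hb a ha
    push_cast at h1 h2
    exact absurd (by omega) hab
  | succ N ih =>
    intro A hA hd
    by_cases hc : ∃ a ∈ A, ∃ b ∈ A, a % 4 ≠ b % 4
    · exact H A hA hc
    push Not at hc
    have hne : A.Nonempty := Finset.card_pos.1 (by omega)
    obtain ⟨c, hcA⟩ := hne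
    have hinj : Set.InjOn (fun x : ℤ => x / 4) (A : Set ℤ) := by
      intro x hx y hy hxy
      have := hc x hx y hy
      simp only at hxy
      omega
    have hB : (A.image (fun x : ℤ => x / 4)).card = n := by
      rw [Finset.card_image_of_injOn hinj, hA]
    have h := ih (A.image (fun x : ℤ => x / 4)) hB (by
      intro a ha b hb
      obtain ⟨a', ha', rfl⟩ := Finset.mem_image.1 ha
      obtain ⟨b', hb', rfl⟩ := Finset.mem_image.1 hb
      have h1 := hc a' ha' b' hb'
      have h2 := hd a' ha' b' hb'
      push_cast at h2
      omega)
    refine h.trans ?_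
    refine Finset.card_le_card_of_injOn (fun x => 4 * x + 5 * (c % 4)) ?_ ?_
    · intro z hz
      obtain ⟨x, hx, y, hy, rfl⟩ := Finset.mem_add.1 hz
      obtain ⟨y', hy', rfl⟩ := Finset.mem_image.1 hy
      obtain ⟨a, ha, rfl⟩ := Finset.mem_image.1 hx
      obtain ⟨b, hb, rfl⟩ := Finset.mem_image.1 hy'
      have h1 := hc a ha c hcA
      have h2 := hc b hb c hcA
      refine Finset.mem_add.2 ⟨a, ha, 4 * b, Finset.mem_image_of_mem _ hb, ?_⟩
      simp only
      omega
    · intro x _ y _ hxy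
      simp only at hxy
      omega

lemma descent (n m : ℕ) (hn : 2 ≤ n)
    (H : ∀ A : Finset ℤ, A.card = n → (∃ a ∈ A, ∃ b ∈ A, a % 4 ≠ b % 4) →
      m ≤ (A + A.image (fun b => (4 : ℤ) * b)).card) (A : Finset ℤ) (hA : A.card = n) :
    m ≤ (A + A.image (fun b => (4 : ℤ) * b)).card := by
  refine descent_aux n m hn H (2 * A.sup Int.natAbs) A hA ?_
  intro a ha b hb
  have h1 : a.natAbs ≤ A.sup Int.natAbs := Finset.le_sup (f := Int.natAbs) ha
  have h2 : b.natAbs ≤ A.sup Int.natAbs := Finset.le_sup (f := Int.natAbs) hb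
  push_cast
  omega

lemma card_img (A : Finset ℤ) : (A.image (fun b => (4 : ℤ) * b)).card = A.card :=
  Finset.card_image_of_injective _ (fun x y h => by have h2 : (4 : ℤ) * x = 4 * y := h; omega)

lemma one_case (A S : Finset ℤ) (hS : S.card = 1) :
    (S + A.image (fun b => (4 : ℤ) * b)).card = A.card := by
  obtain ⟨x, rfl⟩ := Finset.card_eq_one.1 hS
  rw [Finset.card_singleton_add, card_img]

lemma two_case (A S : Finset ℤ) (hSA : S ⊆ A) (hA : A.card ≤ 4) (hS : S.card = 2)
    (hr : ∀ a ∈ S, ∀ b ∈ S, a % 4 = b % 4) :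
    A.card + 2 ≤ (S + A.image (fun b => (4 : ℤ) * b)).card := by
  obtain ⟨x, y, hx, hy, hxy⟩ : ∃ x y, x ∈ S ∧ y ∈ S ∧ x < y := by
    obtain ⟨x, y, h, rfl⟩ := Finset.card_eq_two.1 hS
    rcases lt_or_gt_of_ne h with h | h
    · exact ⟨x, y, by simp, by simp, h⟩
    · exact ⟨y, x, by simp, by simp, h⟩
  have hr1 := hr x hx y hy
  obtain ⟨d, rfl⟩ : ∃ d, y = x + 4 * d := ⟨(y - x) / 4, by omega⟩
  have hd : 0 < d := by omega
  have hne : A.Nonempty := ⟨x, hSA hx⟩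
  obtain ⟨M, hM, hmax⟩ : ∃ M ∈ A, ∀ a ∈ A, a ≤ M := ⟨A.max' hne, A.max'_mem hne, A.le_max'⟩
  have hMx := hmax _ (hSA hy)
  obtain ⟨a, ha, haM, had⟩ : ∃ a ∈ A, a ≠ M ∧ a + d ∉ A := by
    by_contra! hcon
    have h0 := hSA hx
    have h1 := hcon _ h0 (by omega)
    have h2 := hcon _ h1 (by omega)
    have h3 := hcon _ h2 (by omega)
    have h4 := hcon _ h3 (by omega)
    have hsub : ({x, x + d, x + d + d, x + d + d + d, x + d + d + d + d} : Finset ℤ) ⊆ A := by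
      intro z hz
      simp only [Finset.mem_insert, Finset.mem_singleton] at hz
      rcases hz with rfl | rfl | rfl | rfl | rfl <;> assumption
    have hc := Finset.card_le_card hsub
    rw [Finset.card_insert_of_notMem, Finset.card_insert_of_notMem,
      Finset.card_insert_of_notMem, Finset.card_insert_of_notMem, Finset.card_singleton] at hc
    · omega
    all_goals
      simp only [Finset.mem_insert, Finset.mem_singleton]
      omega
  have hMd : M + d ∉ A := fun h => by have := hmax _ h; omega
  have hcard : (insert (a + d) (insert (M + d) A)).card = A.card + 2 := by
    rw [Finset.card_insert_of_notMem, Finset.card_insert_of_notMem hMd]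
    simp only [Finset.mem_insert, not_or]
    exact ⟨by omega, had⟩
  rw [← hcard]
  refine Finset.card_le_card_of_injOn (fun z => x + 4 * z) ?_ ?_
  · intro z hz
    have hz' : z = a + d ∨ z = M + d ∨ z ∈ A := by simpa using hz
    rcases hz' with rfl | rfl | hz'
    · exact Finset.mem_add.2 ⟨_, hy, 4 * a, Finset.mem_image_of_mem _ ha, by ring⟩
    · exact Finset.mem_add.2 ⟨_, hy, 4 * M, Finset.mem_image_of_mem _ hM, by ring⟩
    · exact Finset.mem_add.2 ⟨_, hx, 4 * z, Finset.mem_image_of_mem _ hz', rfl⟩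
  · intro u _ v _ h
    simp only at h
    omega

lemma split_card (A : Finset ℤ) :
    (A + A.image (fun b => (4 : ℤ) * b)).card =
      ∑ r ∈ ({0, 1, 2, 3} : Finset ℤ),
        ((A.filter (fun x => x % 4 = r)) + A.image (fun b => (4 : ℤ) * b)).card := by
  rw [Finset.card_eq_sum_card_fiberwise (f := fun x : ℤ => x % 4)
    (t := ({0, 1, 2, 3} : Finset ℤ))]
  · refine Finset.sum_congr rfl fun r _ => congrArg Finset.card ?_
    ext z
    simp only [Finset.mem_filter, Finset.mem_add, Finset.mem_image]
    constructor
    · rintro ⟨⟨a, ha, _, ⟨b, hb, rfl⟩, rfl⟩, h⟩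
      exact ⟨a, ⟨ha, by omega⟩, _, ⟨b, hb, rfl⟩, rfl⟩
    · rintro ⟨a, ⟨ha, h⟩, _, ⟨b, hb, rfl⟩, rfl⟩
      exact ⟨⟨a, ha, _, ⟨b, hb, rfl⟩, rfl⟩, by omega⟩
  · intro z _
    simp only [Finset.coe_insert, Finset.coe_singleton, Set.mem_insert_iff,
      Set.mem_singleton_iff]
    omega

lemma split_self (A : Finset ℤ) :
    A.card = ∑ r ∈ ({0, 1, 2, 3} : Finset ℤ), (A.filter (fun x => x % 4 = r)).card := by
  refine Finset.card_eq_sum_card_fiberwise ?_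
  intro z _
  simp only [Finset.coe_insert, Finset.coe_singleton, Set.mem_insert_iff,
    Set.mem_singleton_iff]
  omega

lemma class_lt (A : Finset ℤ) (h : ∃ a ∈ A, ∃ b ∈ A, a % 4 ≠ b % 4) (r : ℤ) :
    (A.filter (fun x => x % 4 = r)).card < A.card := by
  refine Finset.card_lt_card (Finset.filter_ssubset.2 ?_)
  obtain ⟨a, ha, b, hb, hab⟩ := h
  by_cases h : a % 4 = r
  · exact ⟨b, hb, by omega⟩
  · exact ⟨a, ha, h⟩

lemma class_two (A : Finset ℤ) (hA : A.card ≤ 4) (r : ℤ)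
    (h : (A.filter (fun x => x % 4 = r)).card = 2) :
    A.card + 2 ≤ ((A.filter (fun x => x % 4 = r)) + A.image (fun b => (4 : ℤ) * b)).card := by
  refine two_case A _ (Finset.filter_subset _ _) hA h ?_
  intro a ha b hb
  rw [(Finset.mem_filter.1 ha).2, (Finset.mem_filter.1 hb).2]

lemma three (A : Finset ℤ) (hA : A.card = 3) :
    8 ≤ (A + A.image (fun b => (4 : ℤ) * b)).card := by
  refine descent 3 8 (by norm_num) ?_ A hA
  intro A hA hex
  have h1 := fun r => one_case A (A.filter (fun x => x % 4 = r))
  have h2 := class_two A (by omega)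
  have h3 := class_lt A hex
  have hs := split_self A
  have hf := split_card A
  simp [Finset.sum_insert, -Finset.card_eq_zero] at hs hf
  have a0 := h1 0; have a1 := h1 1; have a2 := h1 2; have a3 := h1 3
  have b0 := h2 0; have b1 := h2 1; have b2 := h2 2; have b3 := h2 3
  have c0 := h3 0; have c1 := h3 1; have c2 := h3 2; have c3 := h3 3
  simp only [EuclideanDomain.mod_eq_zero] at *
  omega

lemma four (A : Finset ℤ) (hA : A.card = 4) :
    12 ≤ (A + A.image (fun b => (4 : ℤ) * b)).card := by
  refine descent 4 12 (by norm_num) ?_ A hA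
  intro A hA hex
  have h1 := fun r => one_case A (A.filter (fun x => x % 4 = r))
  have h2 := class_two A (by omega)
  have h3 := class_lt A hex
  have h4 : ∀ r : ℤ, (A.filter (fun x => x % 4 = r)).card = 3 →
      8 ≤ ((A.filter (fun x => x % 4 = r)) + A.image (fun b => (4 : ℤ) * b)).card := by
    intro r hr
    refine (three _ hr).trans (Finset.card_le_card ?_)
    exact Finset.add_subset_add_left (Finset.image_subset_image (Finset.filter_subset _ _))
  have hs := split_self A
  have hf := split_card A
  simp [Finset.sum_insert, -Finset.card_eq_zero] at hs hf
  have a0 := h1 0; have a1 := h1 1; have a2 := h1 2; have a3 := h1 3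
  have b0 := h2 0; have b1 := h2 1; have b2 := h2 2; have b3 := h2 3
  have c0 := h3 0; have c1 := h3 1; have c2 := h3 2; have c3 := h3 3
  have d0 := h4 0; have d1 := h4 1; have d2 := h4 2; have d3 := h4 3
  simp only [EuclideanDomain.mod_eq_zero] at *
  omega

lemma two (A : Finset ℤ) (hA : A.card = 2) :
    (A + A.image (fun b => (4 : ℤ) * b)).card = 4 := by
  refine le_antisymm ?_ ?_
  · refine (Finset.card_add_le).trans ?_
    rw [card_img, hA]
  · refine descent 2 4 le_rfl ?_ A hA
    intro A hA hex
    have h1 := fun r => one_case A (A.filter (fun x => x % 4 = r))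
    have h3 := class_lt A hex
    have hs := split_self A
    have hf := split_card A
    simp [Finset.sum_insert, -Finset.card_eq_zero] at hs hf
    have a0 := h1 0; have a1 := h1 1; have a2 := h1 2; have a3 := h1 3
    have c0 := h3 0; have c1 := h3 1; have c2 := h3 2; have c3 := h3 3
    simp only [EuclideanDomain.mod_eq_zero] at *
    omega

/-- Let `A` be a finite set of integers. (i) If `|A| = 2`, then `|A + 4·A| = 4`.
(ii) If `|A| = 3`, then `|A + 4·A| ≥ 8`. (iii) If `|A| = 4`, then `|A + 4·A| ≥ 12`. -/
theorem stmt_15 (A : Finset ℤ) :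
    (A.card = 2 → (A + A.image (fun b => (4 : ℤ) * b)).card = 4) ∧
    (A.card = 3 → 8 ≤ (A + A.image (fun b => (4 : ℤ) * b)).card) ∧
    (A.card = 4 → 12 ≤ (A + A.image (fun b => (4 : ℤ) * b)).card) :=
  ⟨two A, three A, four A⟩
end

section
/- Let A be a finite set of integers with |A| ≥ 5, and suppose the elements of A attain exactly 3 distinct residues modulo 4, so A = A₁ ∪ A₂ ∪ A₃ where A₁, A₂, A₃ are the (nonempty) residue classes of A modulo 4. Then for each index i with |A_i| ≤ 4, |A_i + 4·A| ≥ |A| + 2|A_i| − 2. -/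
open Finset Pointwise

/-- Two elements at distance `4e` in `X`, `|X| ≤ 4`: translates by `e` give two new elements. -/
theorem aux_chain (X : Finset ℤ) (hX : X.card ≤ 4) (y e : ℤ) (he : 0 < e)
    (hy : y ∈ X) (hy4 : y + 4 * e ∈ X) :
    2 ≤ ((X.image (fun x => x + e)) \ X).card := by
  by_contra hlt
  push Not at hlt
  have hne : X.Nonempty := ⟨y, hy⟩
  set M := X.max' hne with hM
  have hMX : M ∈ X := X.max'_mem hne
  have hle : ∀ x ∈ X, x ≤ M := fun x hx => X.le_max' x hx
  have hMe : M + e ∈ (X.image (fun x => x + e)) \ X := by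
    simp only [mem_sdiff, mem_image]
    exact ⟨⟨M, hMX, rfl⟩, fun h => by have := hle _ h; omega⟩
  have step : ∀ x ∈ X, x < M → x + e ∈ X := by
    intro x hx hxM
    by_contra hn
    have h1 : x + e ∈ (X.image (fun x => x + e)) \ X := by
      simp only [mem_sdiff, mem_image]
      exact ⟨⟨x, hx, rfl⟩, hn⟩
    have := Finset.card_le_one.mp (by omega : ((X.image (fun x => x + e)) \ X).card ≤ 1) _ h1 _ hMe
    omega
  have hM4 := hle _ hy4
  have h1 := step y hy (by omega)
  have h2 := step _ h1 (by omega)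
  have h3 := step _ h2 (by omega)
  have hsub : ({y, y + e, y + e + e, y + e + e + e, y + 4 * e} : Finset ℤ) ⊆ X := by
    intro z hz
    simp only [mem_insert, mem_singleton] at hz
    rcases hz with rfl | rfl | rfl | rfl | rfl <;> assumption
  have hc := card_le_card hsub
  have : ({y, y + e, y + e + e, y + e + e + e, y + 4 * e} : Finset ℤ).card = 5 := by
    rw [card_insert_of_notMem, card_insert_of_notMem, card_insert_of_notMem,
      card_insert_of_notMem, card_singleton] <;> simp only [mem_insert, mem_singleton] <;> omega
  omega

theorem aux_two (X : Finset ℤ) (hX : X.card ≤ 4) (c y z : ℤ) (hyz : y < z)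
    (hy : y ∈ X) (hz : z ∈ X) (hmod : y % 4 = z % 4) :
    X.card + 2 ≤ (({y, z} : Finset ℤ) + X.image (fun x => 4 * x + c)).card := by
  obtain ⟨e, rfl⟩ : ∃ e, z = y + 4 * e := ⟨(z - y) / 4, by omega⟩
  have h := aux_chain X hX y e (by omega) hy hz
  have hinj : Function.Injective (fun x : ℤ => 4 * x + c + y) := by
    intro a b hab
    simp only at hab
    omega
  have hsub : (X ∪ ((X.image (fun x => x + e)) \ X)).image (fun x => 4 * x + c + y) ⊆
      (({y, y + 4 * e} : Finset ℤ) + X.image (fun x => 4 * x + c)) := by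
    intro t ht
    simp only [mem_image, mem_union, mem_sdiff] at ht
    obtain ⟨x, hx, rfl⟩ := ht
    rw [mem_add]
    rcases hx with hx | ⟨⟨x', hx', rfl⟩, -⟩
    · exact ⟨y, by simp, 4 * x + c, mem_image_of_mem _ hx, by ring⟩
    · exact ⟨y + 4 * e, by simp, 4 * x' + c, mem_image_of_mem (fun x => 4 * x + c) hx', by ring⟩
  have hc := card_le_card hsub
  rw [card_image_of_injective _ hinj, card_union_of_disjoint disjoint_sdiff] at hc
  omega

/-- Improved bound for the class `4·X + c`. -/
theorem aux_impr (X Y : Finset ℤ) (hX : X.card ≤ 4) (c i : ℤ) (hYX : Y ⊆ X)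
    (hmod : ∀ y ∈ Y, y % 4 = i) (hY : 2 ≤ Y.card) (hY3 : Y.card ≤ 3) :
    X.card + Y.card ≤ (Y + X.image (fun x => 4 * x + c)).card := by
  have hYne : Y.Nonempty := card_pos.mp (by omega)
  have hXne : X.Nonempty := hYne.mono hYX
  rcases (by omega : Y.card = 2 ∨ Y.card = 3) with h2 | h3
  · obtain ⟨y, z, hyz, rfl⟩ := card_eq_two.mp h2
    have hm : y % 4 = z % 4 := by rw [hmod y (by simp), hmod z (by simp)]
    rw [h2]
    rcases lt_or_gt_of_ne hyz with h | h
    · exact aux_two X hX c y z h (hYX (by simp)) (hYX (by simp)) hm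
    · rw [pair_comm]
      exact aux_two X hX c z y h (hYX (by simp)) (hYX (by simp)) hm.symm
  · set M := Y.max' hYne with hM
    have hMY : M ∈ Y := Y.max'_mem hYne
    have hcard : (Y.erase M).card = 2 := by rw [card_erase_of_mem hMY, h3]
    obtain ⟨y, z, hyz, he⟩ := card_eq_two.mp hcard
    have hy : y ∈ Y.erase M := by rw [he]; simp
    have hz : z ∈ Y.erase M := by rw [he]; simp
    have hyY := mem_of_mem_erase hy
    have hzY := mem_of_mem_erase hz
    have hm : y % 4 = z % 4 := by rw [hmod y hyY, hmod z hzY]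
    have key : X.card + 2 ≤ (({y, z} : Finset ℤ) + X.image (fun x => 4 * x + c)).card := by
      rcases lt_or_gt_of_ne hyz with h | h
      · exact aux_two X hX c y z h (hYX hyY) (hYX hzY) hm
      · rw [pair_comm]
        exact aux_two X hX c z y h (hYX hzY) (hYX hyY) hm.symm
    set P := X.max' hXne with hP
    have hPX : P ∈ X := X.max'_mem hXne
    have hss : insert (M + (4 * P + c)) (({y, z} : Finset ℤ) + X.image (fun x => 4 * x + c)) ⊆
        Y + X.image (fun x => 4 * x + c) := by
      rw [insert_subset_iff]
      refine ⟨add_mem_add hMY (mem_image_of_mem (fun x => 4 * x + c) hPX),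
        add_subset_add_right ?_⟩
      rw [← he]
      exact erase_subset _ _
    have hc := card_le_card hss
    rw [card_insert_of_notMem] at hc
    · omega
    · rw [← he, mem_add]
      rintro ⟨a, ha, b, hb, hab⟩
      obtain ⟨x, hx, rfl⟩ := mem_image.mp hb
      have h1 := Y.le_max' a (mem_of_mem_erase ha)
      have h2 := X.le_max' x hx
      have h4 := (mem_erase.mp ha).1
      omega

theorem aux_basic (S T N : Finset ℤ) (hT : T.Nonempty) (h : S + T ⊆ N) :
    1 ≤ S.card → S.card + T.card ≤ N.card + 1 := by
  intro hS
  have h1 := cauchy_davenport_add_of_linearOrder_isCancelAdd (card_pos.mp hS) hT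
  have := card_le_card h
  omega

/-- If two translates fill the same set, the sums agree. -/
theorem aux_sum (S T N : Finset ℤ) (n : ℕ) (h : S + T ⊆ N) (hS : S.card = 1)
    (hT : T.card = n) (hN : N.card = n) :
    ∑ x ∈ N, x = n * ∑ x ∈ S, x + ∑ x ∈ T, x := by
  obtain ⟨s, rfl⟩ := card_eq_one.mp hS
  have hq : {s} + T = T.image (fun t => s + t) := by
    ext z
    simp only [mem_add, mem_singleton, exists_eq_left, mem_image]
  have hc : ({s} + T).card = n := by
    rw [hq, card_image_of_injective _ (add_right_injective s), hT]
  have : {s} + T = N := eq_of_subset_of_card_le h (by omega)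
  rw [← this, hq, sum_image (fun a _ b _ hab => by simpa using hab), sum_add_distrib]
  simp [hT]

theorem aux_mod (S : Finset ℤ) (i : ℤ) (h : ∀ s ∈ S, s % 4 = i) (hS : S.card = 1) :
    (∑ x ∈ S, x) % 4 = i := by
  obtain ⟨s, rfl⟩ := card_eq_one.mp hS
  simpa using h

set_option maxHeartbeats 4000000 in
theorem aux_num (m x0 x1 x2 x3 a0 a1 a2 n0 n1 n2 n3 : ℕ) (f0 f1 f2 f3 g0 g1 g2 h0 h1 h2 h3 : ℤ)
    (hm : m ≤ 4) (hmx : x0 + x1 + x2 + x3 = m) (hm1 : 1 ≤ m)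
    (p0 : 1 ≤ a0) (p1 : 1 ≤ a1) (p2 : 1 ≤ a2)
    (b00 : 1 ≤ x0 → x0 + a0 ≤ n0 + 1)
    (b01 : 1 ≤ x0 → x0 + a1 ≤ n1 + 1)
    (b02 : 1 ≤ x0 → x0 + a2 ≤ n2 + 1)
    (b10 : 1 ≤ x1 → x1 + a0 ≤ n1 + 1)
    (b11 : 1 ≤ x1 → x1 + a1 ≤ n2 + 1)
    (b12 : 1 ≤ x1 → x1 + a2 ≤ n3 + 1)
    (b20 : 1 ≤ x2 → x2 + a0 ≤ n2 + 1)
    (b21 : 1 ≤ x2 → x2 + a1 ≤ n3 + 1)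
    (b22 : 1 ≤ x2 → x2 + a2 ≤ n0 + 1)
    (b30 : 1 ≤ x3 → x3 + a0 ≤ n3 + 1)
    (b31 : 1 ≤ x3 → x3 + a1 ≤ n0 + 1)
    (b32 : 1 ≤ x3 → x3 + a2 ≤ n1 + 1)
    (t00 : x0 = 1 → a0 = m → n0 = m → h0 = m * f0 + g0)
    (t01 : x0 = 1 → a1 = m → n1 = m → h1 = m * f0 + g1)
    (t02 : x0 = 1 → a2 = m → n2 = m → h2 = m * f0 + g2)
    (t10 : x1 = 1 → a0 = m → n1 = m → h1 = m * f1 + g0)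
    (t11 : x1 = 1 → a1 = m → n2 = m → h2 = m * f1 + g1)
    (t12 : x1 = 1 → a2 = m → n3 = m → h3 = m * f1 + g2)
    (t20 : x2 = 1 → a0 = m → n2 = m → h2 = m * f2 + g0)
    (t21 : x2 = 1 → a1 = m → n3 = m → h3 = m * f2 + g1)
    (t22 : x2 = 1 → a2 = m → n0 = m → h0 = m * f2 + g2)
    (t30 : x3 = 1 → a0 = m → n3 = m → h3 = m * f3 + g0)
    (t31 : x3 = 1 → a1 = m → n0 = m → h0 = m * f3 + g1)
    (t32 : x3 = 1 → a2 = m → n1 = m → h1 = m * f3 + g2)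
    (m0 : x0 = 1 → f0 % 4 = 0)
    (m1 : x1 = 1 → f1 % 4 = 1)
    (m2 : x2 = 1 → f2 % 4 = 2)
    (m3 : x3 = 1 → f3 % 4 = 3)
    (hk : (a0 = m ∧ (2 ≤ x0 → x0 ≤ 3 → m + x0 ≤ n0) ∧ (2 ≤ x1 → x1 ≤ 3 → m + x1 ≤ n1) ∧ (2 ≤ x2 → x2 ≤ 3 → m + x2 ≤ n2) ∧ (2 ≤ x3 → x3 ≤ 3 → m + x3 ≤ n3)) ∨
      (a1 = m ∧ (2 ≤ x0 → x0 ≤ 3 → m + x0 ≤ n1) ∧ (2 ≤ x1 → x1 ≤ 3 → m + x1 ≤ n2) ∧ (2 ≤ x2 → x2 ≤ 3 → m + x2 ≤ n3) ∧ (2 ≤ x3 → x3 ≤ 3 → m + x3 ≤ n0)) ∨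
      (a2 = m ∧ (2 ≤ x0 → x0 ≤ 3 → m + x0 ≤ n2) ∧ (2 ≤ x1 → x1 ≤ 3 → m + x1 ≤ n3) ∧ (2 ≤ x2 → x2 ≤ 3 → m + x2 ≤ n0) ∧ (2 ≤ x3 → x3 ≤ 3 → m + x3 ≤ n1))) :
    a0 + a1 + a2 + 2 * m ≤ n0 + n1 + n2 + n3 + 2 := by
  by_contra hcon
  rcases hk with ⟨hk, c0, c1, c2, c3⟩ | ⟨hk, c0, c1, c2, c3⟩ | ⟨hk, c0, c1, c2, c3⟩ <;>
  subst hk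
  all_goals
    have y0 : x0 ≤ 4 := by omega
    have y1 : x1 ≤ 4 - x0 := by omega
    have y2 : x2 ≤ 4 - x0 - x1 := by omega
    have y3 : x3 ≤ 4 - x0 - x1 - x2 := by omega
    interval_cases x0
    all_goals
      try simp only [Nat.reduceSub, tsub_zero] at y1 y2 y3
      interval_cases x1
      all_goals
        try simp only [Nat.reduceSub, tsub_zero] at y2 y3
        interval_cases x2
        all_goals
          try simp only [Nat.reduceSub, tsub_zero] at y3
          interval_cases x3
          all_goals
            simp only [Nat.reduceAdd, Nat.reduceLeDiff, Nat.not_ofNat_le_one, le_refl, forall_const, Nat.reduceEqDiff, OfNat.ofNat_ne_one, zero_ne_one, nonpos_iff_eq_zero, one_ne_zero, IsEmpty.forall_iff, zero_add] at hmx b00 b01 b02 b10 b11 b12 b20 b21 b22 b30 b31 b32 t00 t01 t02 t10 t11 t12 t20 t21 t22 t30 t31 t32 c0 c1 c2 c3 m0 m1 m2 m3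
            try subst hmx
            omega

theorem aux_fiber (S : Finset ℤ) (v : ℤ) :
    S.card = (S.filter (fun a => (a - v) % 4 = 0)).card + (S.filter (fun a => (a - v) % 4 = 1)).card
      + (S.filter (fun a => (a - v) % 4 = 2)).card + (S.filter (fun a => (a - v) % 4 = 3)).card := by
  have h := card_eq_sum_card_fiberwise (s := S) (f := fun a => (a - v) % 4)
    (t := ({0, 1, 2, 3} : Finset ℤ)) (by
      intro a _
      simp only [coe_insert, coe_singleton, Set.mem_insert_iff, Set.mem_singleton_iff]
      omega)
  rw [sum_insert (by decide), sum_insert (by decide), sum_insert (by decide), sum_singleton] at h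
  omega

theorem aux_core (X A : Finset ℤ) (v c k : ℤ) (hk : k = 0 ∨ k = 1 ∨ k = 2)
    (hX1 : 1 ≤ X.card) (hX4 : X.card ≤ 4)
    (hmiss : ∀ a ∈ A, (a - v) % 4 ≠ 3)
    (ne0 : (A.filter (fun a => (a - v) % 4 = 0)).Nonempty)
    (ne1 : (A.filter (fun a => (a - v) % 4 = 1)).Nonempty)
    (ne2 : (A.filter (fun a => (a - v) % 4 = 2)).Nonempty)
    (hAk : A.filter (fun a => (a - v) % 4 = k) = X.image (fun x => 4 * x + c)) :
    A.card + 2 * X.card ≤ (X + A).card + 2 := by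
  have hA := aux_fiber A v
  have hXs := aux_fiber X 0
  have hN := aux_fiber (X + A) v
  have h3 : (A.filter (fun a => (a - v) % 4 = 3)).card = 0 := by
    rw [card_eq_zero, filter_eq_empty_iff]
    exact fun a ha => hmiss a ha
  have hsub : ∀ i j r : ℤ, (i + j) % 4 = r →
      X.filter (fun x => (x - 0) % 4 = i) + A.filter (fun a => (a - v) % 4 = j) ⊆
        (X + A).filter (fun a => (a - v) % 4 = r) := by
    intro i j r hr z hz
    obtain ⟨x, hx, a, ha, rfl⟩ := mem_add.mp hz
    rw [mem_filter] at hx ha ⊢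
    refine ⟨add_mem_add hx.1 ha.1, ?_⟩
    have := hx.2
    have := ha.2
    omega
  have hb : ∀ i j r : ℤ, (A.filter (fun a => (a - v) % 4 = j)).Nonempty → (i + j) % 4 = r →
      1 ≤ (X.filter (fun x => (x - 0) % 4 = i)).card →
      (X.filter (fun x => (x - 0) % 4 = i)).card + (A.filter (fun a => (a - v) % 4 = j)).card ≤
        ((X + A).filter (fun a => (a - v) % 4 = r)).card + 1 :=
    fun i j r hne hr => aux_basic _ _ _ hne (hsub i j r hr)
  have ht : ∀ i j r : ℤ, (i + j) % 4 = r →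
      (X.filter (fun x => (x - 0) % 4 = i)).card = 1 →
      (A.filter (fun a => (a - v) % 4 = j)).card = X.card →
      ((X + A).filter (fun a => (a - v) % 4 = r)).card = X.card →
      ∑ x ∈ (X + A).filter (fun a => (a - v) % 4 = r), x =
        X.card * ∑ x ∈ X.filter (fun x => (x - 0) % 4 = i), x +
          ∑ x ∈ A.filter (fun a => (a - v) % 4 = j), x :=
    fun i j r hr h1 h2 h3 => aux_sum _ _ _ _ (hsub i j r hr) h1 h2 h3
  have hmod : ∀ i : ℤ, (X.filter (fun x => (x - 0) % 4 = i)).card = 1 →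
      (∑ x ∈ X.filter (fun x => (x - 0) % 4 = i), x) % 4 = i := by
    intro i
    apply aux_mod
    intro s hs
    have := (mem_filter.mp hs).2
    omega
  have hck : (A.filter (fun a => (a - v) % 4 = k)).card = X.card := by
    rw [hAk]
    apply card_image_of_injective
    intro a b hab
    simp only at hab
    omega
  have hc : ∀ i r : ℤ, (i + k) % 4 = r → 2 ≤ (X.filter (fun x => (x - 0) % 4 = i)).card →
      (X.filter (fun x => (x - 0) % 4 = i)).card ≤ 3 →
      X.card + (X.filter (fun x => (x - 0) % 4 = i)).card ≤
        ((X + A).filter (fun a => (a - v) % 4 = r)).card := by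
    intro i r hr h2 h3
    have h := hsub i k r hr
    rw [hAk] at h
    refine (aux_impr X _ hX4 c i (filter_subset _ _) ?_ h2 h3).trans (card_le_card h)
    intro s hs
    have := (mem_filter.mp hs).2
    omega
  have key := aux_num X.card _ _ _ _ _ _ _ _ _ _ _ _ _ _ _ _ _ _ _ _ _ _ hX4 hXs.symm hX1
    (card_pos.mpr ne0) (card_pos.mpr ne1) (card_pos.mpr ne2)
    (hb 0 0 0 (ne0) (by norm_num))
    (hb 0 1 1 (ne1) (by norm_num))
    (hb 0 2 2 (ne2) (by norm_num))
    (hb 1 0 1 (ne0) (by norm_num))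
    (hb 1 1 2 (ne1) (by norm_num))
    (hb 1 2 3 (ne2) (by norm_num))
    (hb 2 0 2 (ne0) (by norm_num))
    (hb 2 1 3 (ne1) (by norm_num))
    (hb 2 2 0 (ne2) (by norm_num))
    (hb 3 0 3 (ne0) (by norm_num))
    (hb 3 1 0 (ne1) (by norm_num))
    (hb 3 2 1 (ne2) (by norm_num))
    (ht 0 0 0 (by norm_num))
    (ht 0 1 1 (by norm_num))
    (ht 0 2 2 (by norm_num))
    (ht 1 0 1 (by norm_num))
    (ht 1 1 2 (by norm_num))
    (ht 1 2 3 (by norm_num))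
    (ht 2 0 2 (by norm_num))
    (ht 2 1 3 (by norm_num))
    (ht 2 2 0 (by norm_num))
    (ht 3 0 3 (by norm_num))
    (ht 3 1 0 (by norm_num))
    (ht 3 2 1 (by norm_num))
    (hmod 0)
    (hmod 1)
    (hmod 2)
    (hmod 3)
    (by
      rcases hk with rfl | rfl | rfl
      · exact Or.inl ⟨hck, hc 0 0 (by norm_num), hc 1 1 (by norm_num), hc 2 2 (by norm_num), hc 3 3 (by norm_num)⟩
      · exact Or.inr (Or.inl ⟨hck, hc 0 1 (by norm_num), hc 1 2 (by norm_num), hc 2 3 (by norm_num), hc 3 0 (by norm_num)⟩)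
      · exact Or.inr (Or.inr ⟨hck, hc 0 2 (by norm_num), hc 1 3 (by norm_num), hc 2 0 (by norm_num), hc 3 1 (by norm_num)⟩))
  omega

/-- Let `A` be a finite set of integers with `|A| ≥ 5` attaining exactly 3 distinct residues
modulo 4, with residue classes `A_u = {a ∈ A : a ≡ u (mod 4)}`. Then for each attained
residue `u` with `|A_u| ≤ 4`, we have `|A_u + 4·A| ≥ |A| + 2|A_u| − 2`. -/
theorem stmt_16 (A : Finset ℤ) (hA : 5 ≤ A.card)
    (h3 : (A.image (fun a => a % 4)).card = 3)
    (u : ℤ) (hu : u ∈ A.image (fun a => a % 4))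
    (hcard : (A.filter (fun a => a % 4 = u)).card ≤ 4) :
    (A.card : ℤ) + 2 * (A.filter (fun a => a % 4 = u)).card - 2 ≤
      (((A.filter (fun a => a % 4 = u)) + A.image (fun b => (4 : ℤ) * b)).card : ℤ) := by
  have hsub : A.image (fun a => a % 4) ⊆ ({0, 1, 2, 3} : Finset ℤ) := by
    intro r hr
    obtain ⟨a, _, rfl⟩ := mem_image.mp hr
    simp only [mem_insert, mem_singleton]
    omega
  have hd : (({0, 1, 2, 3} : Finset ℤ) \ A.image (fun a => a % 4)).card = 1 := by
    rw [card_sdiff_of_subset hsub, h3]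
    decide
  obtain ⟨w, hw⟩ := card_eq_one.mp hd
  have hwm : ∀ r : ℤ, 0 ≤ r → r < 4 → (r ∉ A.image (fun a => a % 4) ↔ r = w) := by
    intro r h0 h4
    rw [← mem_singleton, ← hw, mem_sdiff]
    have : r ∈ ({0, 1, 2, 3} : Finset ℤ) := by
      simp only [mem_insert, mem_singleton]
      omega
    tauto
  have hne : ∀ j : ℤ, j = 0 ∨ j = 1 ∨ j = 2 →
      (A.filter (fun a => (a - (w + 1)) % 4 = j)).Nonempty := by
    intro j hj
    have hr : (w + 1 + j) % 4 ∈ A.image (fun a => a % 4) := by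
      by_contra hn
      have := (hwm _ (by omega) (by omega)).mp hn
      omega
    obtain ⟨a, ha, hae⟩ := mem_image.mp hr
    exact ⟨a, mem_filter.mpr ⟨ha, by omega⟩⟩
  have hwn : w ∉ A.image (fun a => a % 4) := by
    have : w ∈ ({0, 1, 2, 3} : Finset ℤ) \ A.image (fun a => a % 4) := by
      rw [hw]
      simp
    exact (mem_sdiff.mp this).2
  have hw4 : 0 ≤ w ∧ w < 4 := by
    have : w ∈ ({0, 1, 2, 3} : Finset ℤ) \ A.image (fun a => a % 4) := by
      rw [hw]
      simp
    have := (mem_sdiff.mp this).1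
    simp only [mem_insert, mem_singleton] at this
    omega
  have hmiss : ∀ a ∈ A, a % 4 ≠ w := fun a ha h => hwn (mem_image.mpr ⟨a, ha, h⟩)
  obtain ⟨a0, ha0, hau⟩ := mem_image.mp hu
  have huw := hmiss a0 ha0
  set B := A.filter (fun a => a % 4 = u) with hB
  set X := B.image (fun b => b / 4) with hX
  have hBmod : ∀ b ∈ B, b % 4 = u := fun b hb => (mem_filter.mp hb).2
  have hBX : B = X.image (fun x => 4 * x + u) := by
    rw [hX, image_image]
    ext z
    simp only [mem_image, Function.comp]
    constructor
    · intro hz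
      exact ⟨z, hz, by have := hBmod z hz; omega⟩
    · rintro ⟨b, hb, rfl⟩
      have h1 := hBmod b hb
      rwa [show 4 * (b / 4) + u = b by omega]
  have hinj : Function.Injective (fun x : ℤ => 4 * x + u) := by
    intro a b hab
    simp only at hab
    omega
  have hXB : X.card = B.card := by
    conv_rhs => rw [hBX]
    rw [card_image_of_injective _ hinj]
  have hsum : B + A.image (fun b => (4 : ℤ) * b) = (X + A).image (fun x => 4 * x + u) := by
    rw [hBX]
    ext z
    simp only [mem_add, mem_image]
    constructor
    · rintro ⟨_, ⟨x, hx, rfl⟩, _, ⟨a, ha, rfl⟩, rfl⟩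
      exact ⟨x + a, ⟨x, hx, a, ha, rfl⟩, by ring⟩
    · rintro ⟨_, ⟨x, hx, a, ha, rfl⟩, rfl⟩
      exact ⟨4 * x + u, ⟨x, hx, rfl⟩, 4 * a, ⟨a, ha, rfl⟩, by ring⟩
  have hBpos : 1 ≤ B.card := card_pos.mpr ⟨a0, mem_filter.mpr ⟨ha0, hau⟩⟩
  have key := aux_core X A (w + 1) u ((u - (w + 1)) % 4) (by omega) (by omega) (by omega)
    (fun a ha h => hmiss a ha (by omega)) (hne 0 (by norm_num)) (hne 1 (by norm_num))
    (hne 2 (by norm_num)) (by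
      rw [← hBX, hB]
      apply filter_congr
      intro a _
      omega)
  rw [hsum, card_image_of_injective _ hinj]
  omega
end

section
/- Let A be a finite set of integers with |A| ≥ 5, and suppose the elements of A attain exactly 2 distinct residues modulo 4, say u₁ and u₂ with u₁ = 0 and u₂ odd. Write A = A₁ ∪ A₂ where A_i = {a ∈ A : a ≡ u_i (mod 4)}. Then for each index i ∈ {1, 2} with |A_i| ≤ 4, |A_i + 4·A| ≥ |A| + 3|A_i| − 3. -/
open Finset Pointwise

namespace Stmt17

/-- elements of `X` congruent to `r` mod 4 -/
def cls (X : Finset ℤ) (r : ℤ) : Finset ℤ := X.filter (fun x => (4:ℤ) ∣ x - r)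

/-- dilation by 4 followed by a shift -/
def dil (X : Finset ℤ) (u : ℤ) : Finset ℤ := X.image (fun x => 4 * x + u)

lemma mem_cls {X : Finset ℤ} {r x : ℤ} : x ∈ cls X r ↔ x ∈ X ∧ (4:ℤ) ∣ x - r := by
  simp [cls]

lemma mem_dil {X : Finset ℤ} {u x : ℤ} : x ∈ dil X u ↔ ∃ y ∈ X, 4 * y + u = x := by
  simp [dil]

lemma card_dil (X : Finset ℤ) (u : ℤ) : (dil X u).card = X.card := by
  apply card_image_of_injective
  intro a b h
  simp only at h
  omega

lemma cd (X Y : Finset ℤ) (hX : 1 ≤ X.card) (hY : 1 ≤ Y.card) :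
    X.card + Y.card ≤ (X + Y).card + 1 := by
  have := cauchy_davenport_add_of_linearOrder_isCancelAdd (s := X) (t := Y)
    (card_pos.1 hX) (card_pos.1 hY)
  omega

lemma card_split (X : Finset ℤ) (u : ℤ) (hu : Odd u) :
    X.card = (cls X 0).card + (cls X u).card + (cls X (2*u)).card + (cls X (3*u)).card := by
  obtain ⟨v, hv⟩ := hu
  have hX : X = ((cls X 0 ∪ cls X u) ∪ cls X (2*u)) ∪ cls X (3*u) := by
    ext x
    simp only [mem_union, mem_cls]
    constructor
    · intro h
      simp only [h, true_and]
      have hu4 : u % 4 = 1 ∨ u % 4 = 3 := by omega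
      have hx4 : x % 4 = 0 ∨ x % 4 = 1 ∨ x % 4 = 2 ∨ x % 4 = 3 := by omega
      rcases hu4 with h1 | h1 <;> rcases hx4 with h2 | h2 | h2 | h2 <;> omega
    · tauto
  conv_lhs => rw [hX]
  rw [card_union_of_disjoint, card_union_of_disjoint, card_union_of_disjoint] <;>
  · rw [disjoint_left]
    intro x
    simp only [mem_union, mem_cls]
    omega

lemma cls_congr (X : Finset ℤ) (r s : ℤ) (h : (4:ℤ) ∣ r - s) : cls X r = cls X s := by
  ext x
  simp only [mem_cls]
  constructor
  · rintro ⟨h1, h2⟩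
    exact ⟨h1, by omega⟩
  · rintro ⟨h1, h2⟩
    exact ⟨h1, by omega⟩

/-- a set in a single class mod 4 is a dilate -/
lemma exists_dil (X : Finset ℤ) (r : ℤ) (h : ∀ x ∈ X, (4:ℤ) ∣ x - r) : ∃ D, X = dil D r := by
  refine ⟨X.image (fun x => (x - r) / 4), ?_⟩
  ext x
  simp only [mem_dil, mem_image]
  constructor
  · intro hx
    exact ⟨(x - r) / 4, ⟨x, hx, rfl⟩, by have := h x hx; omega⟩
  · rintro ⟨_, ⟨y, hy, rfl⟩, rfl⟩
    have := h y hy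
    have e : 4 * ((y - r) / 4) + r = y := by omega
    rwa [e]

/-- `(4 X + a) + (4 Y + b)` is a dilate of `X + Y` -/
lemma dil_add_dil (X Y : Finset ℤ) (a b : ℤ) : dil X a + dil Y b = dil (X + Y) (a + b) := by
  ext x
  simp only [mem_add, mem_dil]
  constructor
  · rintro ⟨_, ⟨p, hp, rfl⟩, _, ⟨q, hq, rfl⟩, rfl⟩
    exact ⟨p + q, ⟨p, hp, q, hq, rfl⟩, by ring⟩
  · rintro ⟨_, ⟨p, hp, q, hq, rfl⟩, rfl⟩
    exact ⟨_, ⟨p, hp, rfl⟩, _, ⟨q, hq, rfl⟩, by ring⟩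

/-- `|B + 4B| ≥ 3|B| - 2` -/
lemma self_bound (N : ℕ) : ∀ B : Finset ℤ, (∀ x ∈ B, ∀ y ∈ B, x - y ≤ N) →
    3 * B.card ≤ (B + dil B 0).card + 2 := by
  induction N using Nat.strong_induction_on with
  | _ N ih =>
  intro B hB
  rcases Nat.lt_or_ge B.card 2 with hc | hc
  · rcases Nat.eq_zero_or_pos B.card with h0 | h0
    · omega
    · have := cd B (dil B 0) h0 (by rw [card_dil]; exact h0)
      rw [card_dil] at this
      omega
  obtain ⟨x, hx, y, hy, hxy⟩ := one_lt_card.1 hc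
  have hN : 0 < N := by
    have h1 := hB x hx y hy
    have h2 := hB y hy x hx
    omega
  by_cases hall : ∀ z ∈ B, (4:ℤ) ∣ z - x
  · obtain ⟨D, hD⟩ := exists_dil B x hall
    have h1 := ih (N / 4) (by omega) D (by
      intro p hp q hq
      have := hB (4 * p + x) (by rw [hD, mem_dil]; exact ⟨p, hp, rfl⟩)
        (4 * q + x) (by rw [hD, mem_dil]; exact ⟨q, hq, rfl⟩)
      push_cast
      omega)
    have h2 : B + dil B 0 = dil (D + dil D x) x := by
      conv_lhs => rw [hD]
      rw [dil_add_dil, add_zero]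
    have h3 : D + dil D x = (D + dil D 0).image (fun t => t + x) := by
      ext t
      simp only [mem_add, mem_dil, mem_image]
      constructor
      · rintro ⟨p, hp, _, ⟨q, hq, rfl⟩, rfl⟩
        exact ⟨_, ⟨p, hp, _, ⟨q, hq, rfl⟩, rfl⟩, by ring⟩
      · rintro ⟨_, ⟨p, hp, _, ⟨q, hq, rfl⟩, rfl⟩, rfl⟩
        exact ⟨p, hp, _, ⟨q, hq, rfl⟩, by ring⟩
    have h4 : (D + dil D x).card = (D + dil D 0).card := by
      rw [h3]
      exact card_image_of_injective _ (add_left_injective x)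
    have h5 : B.card = D.card := by rw [hD, card_dil]
    rw [h2, card_dil, h4, h5]
    exact h1
  · push Not at hall
    obtain ⟨z, hz, hzx⟩ := hall
    set P := B.filter (fun t => (4:ℤ) ∣ t - x)
    set Q := B.filter (fun t => ¬ (4:ℤ) ∣ t - x)
    have hPQ : P.card + Q.card = B.card := card_filter_add_card_filter_not _
    have hP : 1 ≤ P.card := card_pos.2 ⟨x, by simp [P, hx]⟩
    have hQ : 1 ≤ Q.card := card_pos.2 ⟨z, by simp [Q, hz, hzx]⟩
    have hB1 : 1 ≤ (dil B 0).card := by rw [card_dil]; omega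
    have a1 := cd P (dil B 0) hP hB1
    have a2 := cd Q (dil B 0) hQ hB1
    have hd : Disjoint (P + dil B 0) (Q + dil B 0) := by
      rw [disjoint_left]
      intro t ht ht'
      simp only [mem_add, mem_dil, P, Q, mem_filter] at ht ht'
      obtain ⟨p, ⟨_, hp⟩, _, ⟨q, hq, rfl⟩, rfl⟩ := ht
      obtain ⟨p', ⟨_, hp'⟩, _, ⟨q', hq', rfl⟩, h⟩ := ht'
      omega
    have hsub : (P + dil B 0) ∪ (Q + dil B 0) ⊆ B + dil B 0 :=
      union_subset (add_subset_add_right (filter_subset _ _))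
        (add_subset_add_right (filter_subset _ _))
    have := card_le_card hsub
    rw [card_union_of_disjoint hd] at this
    rw [card_dil] at a1 a2
    omega

lemma self_bound' (B : Finset ℤ) : 3 * B.card ≤ (B + dil B 0).card + 2 := by
  rcases B.eq_empty_or_nonempty with rfl | hne
  · simp
  · refine self_bound (B.max' hne - B.min' hne).toNat B ?_
    intro x hx y hy
    have h1 := B.le_max' x hx
    have h2 := B.min'_le y hy
    omega

/-- the sumset -/
def S (B C : Finset ℤ) (u : ℤ) : Finset ℤ := B + (dil B 0 ∪ dil C u)

lemma sub1 (B C : Finset ℤ) (u r : ℤ) : cls B r + dil B 0 ⊆ cls (S B C u) r := by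
  intro t ht
  simp only [mem_add, mem_dil, mem_cls] at ht
  obtain ⟨p, ⟨hp, hp'⟩, _, ⟨q, hq, rfl⟩, rfl⟩ := ht
  rw [mem_cls]
  refine ⟨add_mem_add hp (mem_union_left _ (mem_dil.2 ⟨q, hq, rfl⟩)), by omega⟩

lemma sub2 (B C : Finset ℤ) (u r : ℤ) : cls B r + dil C u ⊆ cls (S B C u) (r + u) := by
  intro t ht
  simp only [mem_add, mem_dil, mem_cls] at ht
  obtain ⟨p, ⟨hp, hp'⟩, _, ⟨q, hq, rfl⟩, rfl⟩ := ht
  rw [mem_cls]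
  refine ⟨add_mem_add hp (mem_union_right _ (mem_dil.2 ⟨q, hq, rfl⟩)), by omega⟩

lemma cls_le (B : Finset ℤ) (r : ℤ) : (cls B r).card ≤ B.card := card_le_card (filter_subset _ _)

lemma fact1 (B C : Finset ℤ) (u r : ℤ) (h : 1 ≤ (cls B r).card) :
    B.card + (cls B r).card ≤ (cls (S B C u) r).card + 1 := by
  have h0 := cls_le B r
  have h1 := cd (cls B r) (dil B 0) h (by rw [card_dil]; omega)
  have h2 := card_le_card (sub1 B C u r)
  rw [card_dil] at h1
  omega

lemma fact2 (B C : Finset ℤ) (u r : ℤ) (hC : 1 ≤ C.card) (h : 1 ≤ (cls B r).card) :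
    C.card + (cls B r).card ≤ (cls (S B C u) (r + u)).card + 1 := by
  have h1 := cd (cls B r) (dil C u) h (by rw [card_dil]; omega)
  have h2 := card_le_card (sub2 B C u r)
  rw [card_dil] at h1
  omega

lemma chain (B : Finset ℤ) (hk : B.card ≤ 4) (a d : ℤ) (hd : 0 < d) (ha : a ∈ B)
    (hb : a + 4 * d ∈ B) : B.card + 2 ≤ (B ∪ B.image (fun x => x + d)).card := by
  have hne : B.Nonempty := ⟨a, ha⟩
  have hmin := B.min'_mem hne
  have hs2 : ∃ s ∈ B, a < s ∧ s - d ∉ B := by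
    by_contra hcon
    push Not at hcon
    have h3 := hcon _ hb (by omega)
    have h2 := hcon _ h3 (by omega)
    have h1 := hcon _ h2 (by omega)
    have hsub : ({a, a + 4*d, a + 4*d - d, a + 4*d - d - d, a + 4*d - d - d - d} : Finset ℤ) ⊆ B := by
      intro t
      simp only [mem_insert, mem_singleton]
      rintro (rfl | rfl | rfl | rfl | rfl) <;> assumption
    have := card_le_card hsub
    rw [card_insert_of_notMem, card_insert_of_notMem, card_insert_of_notMem,
      card_insert_of_notMem, card_singleton] at this
    · omega
    all_goals
      simp only [mem_insert, mem_singleton]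
      omega
  obtain ⟨s, hs, has, hsd⟩ := hs2
  have hma := B.min'_le a ha
  have hc : (B.image (fun x => x + d)).card = B.card :=
    card_image_of_injective _ (add_left_injective d)
  have hsub : ({B.min' hne, s} : Finset ℤ) ∪ B.image (fun x => x + d) ⊆
      B ∪ B.image (fun x => x + d) := by
    apply union_subset_union_left
    intro t
    simp only [mem_insert, mem_singleton]
    rintro (rfl | rfl) <;> assumption
  have h1 := card_le_card hsub
  rw [card_union_of_disjoint, card_pair (by omega), hc] at h1
  · omega
  · rw [disjoint_left]
    intro t
    simp only [mem_insert, mem_singleton, mem_image]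
    rintro (rfl | rfl) ⟨x, hx, hxt⟩
    · have := B.min'_le x hx
      omega
    · apply hsd
      rw [← hxt]
      simpa using hx

lemma fact3 (B C : Finset ℤ) (u r : ℤ) (hk : B.card ≤ 4) (h : (cls B r).card = 2) :
    B.card + 2 ≤ (cls (S B C u) r).card := by
  refine le_trans ?_ (card_le_card (sub1 B C u r))
  have : ∃ a b, a < b ∧ a ∈ cls B r ∧ b ∈ cls B r := by
    obtain ⟨x, y, hxy, h⟩ := card_eq_two.1 h
    rcases lt_or_gt_of_ne hxy with hl | hl
    · exact ⟨x, y, hl, by simp [h], by simp [h]⟩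
    · exact ⟨y, x, hl, by simp [h], by simp [h]⟩
  obtain ⟨a, b, hab, ha, hb⟩ := this
  have ha' := mem_cls.1 ha
  have hb' := mem_cls.1 hb
  obtain ⟨d, hd⟩ : ∃ d, b = a + 4 * d := ⟨(b - a) / 4, by omega⟩
  have hch := chain B hk a d (by omega) ha'.1 (hd ▸ hb'.1)
  refine le_trans hch ?_
  rw [← card_dil _ a]
  apply card_le_card
  intro t ht
  simp only [mem_dil, mem_union, mem_image] at ht
  obtain ⟨y, hy | ⟨z, hz, rfl⟩, rfl⟩ := ht
  · exact mem_add.2 ⟨a, ha, 4 * y + 0, mem_dil.2 ⟨y, hy, rfl⟩, by ring⟩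
  · exact mem_add.2 ⟨b, hb, 4 * z + 0, mem_dil.2 ⟨z, hz, rfl⟩, by rw [hd]; ring⟩

lemma fact7 (B C : Finset ℤ) (u r : ℤ) (hu : Odd u) (hB : 1 ≤ B.card) (hC : 1 ≤ C.card)
    (h1 : (cls B (r + u)).card = 0) (h3 : (cls B (r + 3 * u)).card = 0) :
    4 * B.card + C.card ≤ (S B C u).card + 3 := by
  obtain ⟨v, hv⟩ := hu
  have hpar : ∀ x ∈ B, (2:ℤ) ∣ x - r := by
    intro x hx
    rw [card_eq_zero] at h1 h3
    have n1 : x ∉ cls B (r + u) := by simp [h1]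
    have n3 : x ∉ cls B (r + 3 * u) := by simp [h3]
    simp only [mem_cls, hx, true_and] at n1 n3
    omega
  have e : S B C u = (B + dil B 0) ∪ (B + dil C u) := by rw [S, add_union]
  rw [e, card_union_of_disjoint]
  · have a1 := self_bound' B
    have a2 := cd B (dil C u) hB (by rw [card_dil]; exact hC)
    rw [card_dil] at a2
    omega
  · rw [disjoint_left]
    intro t ht ht'
    simp only [mem_add, mem_dil] at ht ht'
    obtain ⟨p, hp, _, ⟨q, hq, rfl⟩, rfl⟩ := ht
    obtain ⟨p', hp', _, ⟨q', hq', rfl⟩, h⟩ := ht'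
    have := hpar p hp
    have := hpar p' hp'
    omega

lemma small (D C : Finset ℤ) (u : ℤ) (hu : Odd u) (hD : D.card = 3) (hC : C.card = 1) :
    9 ≤ (S D C u).card := by
  have sB := card_split D u hu
  have sS := card_split (S D C u) u hu
  have c0 : cls (S D C u) (3 * u + u) = cls (S D C u) 0 := cls_congr _ _ _ (by omega)
  have c3 : cls D (u + 3 * u) = cls D 0 := cls_congr _ _ _ (by omega)
  have e1 : u + u = 2 * u := by ring
  have e2 : 2 * u + u = 3 * u := by ring
  have a0 := fact1 D C u 0
  have a1 := fact1 D C u u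
  have a2 := fact1 D C u (2*u)
  have a3 := fact1 D C u (3*u)
  have b0 := fact2 D C u 0 (by omega)
  have b1 := fact2 D C u u (by omega)
  have b2 := fact2 D C u (2*u) (by omega)
  have b3 := fact2 D C u (3*u) (by omega)
  have d0 := fact3 D C u 0 (by omega)
  have d1 := fact3 D C u u (by omega)
  have d2 := fact3 D C u (2*u) (by omega)
  have d3 := fact3 D C u (3*u) (by omega)
  have g0 := fact7 D C u 0 hu (by omega) (by omega)
  have g1 := fact7 D C u u hu (by omega) (by omega)
  simp only [c0, c3, e1, e2, zero_add] at b0 b1 b2 b3 g0 g1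
  omega

lemma fact4 (B C : Finset ℤ) (u r s : ℤ) (hs : Odd s) (h : (cls B r).card = 3)
    (h' : (cls B (r + s)).card = 1) : 9 ≤ (cls (S B C u) r).card := by
  refine le_trans ?_ (card_le_card (sub1 B C u r))
  obtain ⟨D, hD⟩ := exists_dil (cls B r) r (fun x hx => (mem_cls.1 hx).2)
  obtain ⟨y, hy⟩ := card_pos.1 (by omega : 0 < (cls B (r + s)).card)
  have hy' := mem_cls.1 hy
  have hDc : D.card = 3 := by rw [← card_dil D r, ← hD, h]
  have hodd : Odd (y - r) := by
    obtain ⟨v, hv⟩ := hs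
    obtain ⟨w, hw⟩ := hy'.2
    exact ⟨v + 2 * w, by omega⟩
  refine le_trans (small D {0} (y - r) hodd hDc (by simp)) ?_
  rw [← card_dil _ (5 * r)]
  apply card_le_card
  intro t ht
  have hsub : ∀ p ∈ D, 4 * p + r ∈ cls B r := fun p hp => by
    rw [hD]; exact mem_dil.2 ⟨p, hp, rfl⟩
  simp only [S, mem_dil, mem_add, mem_union, mem_singleton] at ht
  obtain ⟨_, ⟨p, hp, _, ⟨q, hq, rfl⟩ | ⟨q, rfl, rfl⟩, rfl⟩, rfl⟩ := ht
  · exact mem_add.2 ⟨_, hsub p hp, _,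
      mem_dil.2 ⟨_, (mem_cls.1 (hsub q hq)).1, rfl⟩, by ring⟩
  · exact mem_add.2 ⟨_, hsub p hp, _, mem_dil.2 ⟨_, hy'.1, rfl⟩, by ring⟩

lemma fact5 (B C : Finset ℤ) (u r : ℤ) (hC : C.card = 2)
    (h : (cls B r).card = 2) (h' : (cls B (r + u)).card = 1) :
    4 ≤ (cls (S B C u) (r + u)).card := by
  by_contra hcon
  set F := cls (S B C u) (r + u) with hF
  obtain ⟨y₁, y₂, hy, hY⟩ := card_eq_two.1 h
  obtain ⟨c₁, c₂, hc, hCe⟩ := card_eq_two.1 hC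
  obtain ⟨b, hb⟩ := card_eq_one.1 h'
  have hbm : b ∈ cls B (r + u) := by simp [hb]
  have hy1 : y₁ ∈ cls B r := by simp [hY]
  have hy2 : y₂ ∈ cls B r := by simp [hY]
  have hTF := sub2 B C u r
  have hT := cd (cls B r) (dil C u) (by omega) (by rw [card_dil]; omega)
  rw [card_dil] at hT
  have hEq : cls B r + dil C u = F := eq_of_subset_of_card_le hTF (by omega)
  have m1 : b + (4 * y₁ + 0) ∈ F := sub1 B C u (r + u)
    (add_mem_add hbm (mem_dil.2 ⟨y₁, (mem_cls.1 hy1).1, rfl⟩))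
  have m2 : b + (4 * y₂ + 0) ∈ F := sub1 B C u (r + u)
    (add_mem_add hbm (mem_dil.2 ⟨y₂, (mem_cls.1 hy2).1, rfl⟩))
  have hF4 : F = {y₁ + (4 * c₁ + u), y₁ + (4 * c₂ + u), y₂ + (4 * c₁ + u), y₂ + (4 * c₂ + u)} := by
    rw [← hEq, hY, hCe]
    ext t
    simp only [mem_add, mem_dil, mem_insert, mem_singleton]
    constructor
    · rintro ⟨p, rfl | rfl, _, ⟨q, rfl | rfl, rfl⟩, rfl⟩ <;> simp
    · rintro (rfl | rfl | rfl | rfl)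
      · exact ⟨y₁, by simp, _, ⟨c₁, by simp, rfl⟩, rfl⟩
      · exact ⟨y₁, by simp, _, ⟨c₂, by simp, rfl⟩, rfl⟩
      · exact ⟨y₂, by simp, _, ⟨c₁, by simp, rfl⟩, rfl⟩
      · exact ⟨y₂, by simp, _, ⟨c₂, by simp, rfl⟩, rfl⟩
  have hcol : 4 * (c₂ - c₁) = y₂ - y₁ ∨ 4 * (c₂ - c₁) = y₁ - y₂ := by
    by_contra hno
    apply hcon
    rw [hF4, card_insert_of_notMem, card_insert_of_notMem, card_insert_of_notMem, card_singleton]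
    all_goals
      simp only [mem_insert, mem_singleton]
      omega
  rw [hF4] at m1 m2
  simp only [mem_insert, mem_singleton] at m1 m2
  omega

lemma fact6 (B C : Finset ℤ) (u : ℤ) (hu : Odd u) (hB : B.card = 4) (hC : C.card = 4)
    (h0 : (cls B 0).card = 1) (h1 : (cls B u).card = 1) (h2 : (cls B (2 * u)).card = 1)
    (h3 : (cls B (3 * u)).card = 1) :
    17 ≤ (S B C u).card := by
  have key : ∀ r r' : ℤ, (4:ℤ) ∣ r + u - r' → ∀ b b', cls B r = {b} → cls B r' = {b'} →
      (cls (S B C u) r').card ≤ 4 → ∑ x ∈ B, x + b' = ∑ x ∈ C, x + u + b := by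
    intro r r' hr b b' hb hb' hF
    have s1 := sub1 B C u r'
    have s2 := sub2 B C u r
    rw [cls_congr _ _ _ hr] at s2
    rw [hb'] at s1
    rw [hb] at s2
    have E1 := eq_of_subset_of_card_le s1 (by
      rw [singleton_add, vadd_finset_def]
      have := card_image_of_injective (dil B 0) (add_right_injective b')
      rw [card_dil] at this
      simp only [vadd_eq_add]
      omega)
    have E2 := eq_of_subset_of_card_le s2 (by
      rw [singleton_add, vadd_finset_def]
      have := card_image_of_injective (dil C u) (add_right_injective b)
      rw [card_dil] at this
      simp only [vadd_eq_add]
      omega)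
    have E : ({b'} : Finset ℤ) + dil B 0 = {b} + dil C u := E1.trans E2.symm
    have E' := congrArg (fun T : Finset ℤ => ∑ x ∈ T, x) E
    simp only [singleton_add, vadd_finset_def, dil, image_image] at E'
    rw [sum_image (by intro x _ y _ h; simp at h; exact h),
      sum_image (by intro x _ y _ h; simp at h; exact h)] at E'
    simp only [Function.comp, vadd_eq_add, sum_add_distrib, sum_const, hB, hC] at E'
    simp at E'
    rw [← mul_sum, ← mul_sum] at E'
    linarith
  obtain ⟨b0, hb0⟩ := card_eq_one.1 h0
  obtain ⟨b1, hb1⟩ := card_eq_one.1 h1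
  obtain ⟨b2, hb2⟩ := card_eq_one.1 h2
  obtain ⟨b3, hb3⟩ := card_eq_one.1 h3
  have k1 := key 0 u (by omega) _ _ hb0 hb1
  have k2 := key u (2*u) (by omega) _ _ hb1 hb2
  have k3 := key (2*u) (3*u) (by omega) _ _ hb2 hb3
  have k0 := key (3*u) 0 (by omega) _ _ hb3 hb0
  have a0 := fact1 B C u 0
  have a1 := fact1 B C u u
  have a2 := fact1 B C u (2*u)
  have a3 := fact1 B C u (3*u)
  have sS := card_split (S B C u) u hu
  by_contra hcon
  have k1 := k1 (by omega)
  have k2 := k2 (by omega)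
  have k3 := k3 (by omega)
  have k0 := k0 (by omega)
  have m0 : b0 ∈ cls B 0 := by simp [hb0]
  have m1 : b1 ∈ cls B u := by simp [hb1]
  have q0 := (mem_cls.1 m0).2
  have q1 := (mem_cls.1 m1).2
  obtain ⟨v, hv⟩ := hu
  omega

set_option maxHeartbeats 4000000 in
lemma core (B C : Finset ℤ) (u : ℤ) (hu : Odd u) (hB : 1 ≤ B.card) (hB4 : B.card ≤ 4)
    (hC : 1 ≤ C.card) (hBC : 5 ≤ B.card + C.card) :
    4 * B.card + C.card ≤ (S B C u).card + 3 := by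
  have sB := card_split B u hu
  have sS := card_split (S B C u) u hu
  have c0 : cls (S B C u) (3 * u + u) = cls (S B C u) 0 := cls_congr _ _ _ (by omega)
  have c3 : cls B (u + 3 * u) = cls B 0 := cls_congr _ _ _ (by omega)
  have c4 : cls B (3 * u + u) = cls B 0 := cls_congr _ _ _ (by omega)
  have e1 : u + u = 2 * u := by ring
  have e2 : 2 * u + u = 3 * u := by ring
  have z0 : cls B (0 + -u) = cls B (3 * u) := cls_congr _ _ _ (by omega)
  have z1 : cls B (u + -u) = cls B 0 := cls_congr _ _ _ (by omega)
  have z2 : cls B (2 * u + -u) = cls B u := cls_congr _ _ _ (by omega)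
  have z3 : cls B (3 * u + -u) = cls B (2 * u) := cls_congr _ _ _ (by omega)
  have a0 := fact1 B C u 0
  have a1 := fact1 B C u u
  have a2 := fact1 B C u (2*u)
  have a3 := fact1 B C u (3*u)
  have b0 := fact2 B C u 0 (by omega)
  have b1 := fact2 B C u u (by omega)
  have b2 := fact2 B C u (2*u) (by omega)
  have b3 := fact2 B C u (3*u) (by omega)
  have d0 := fact3 B C u 0 (by omega)
  have d1 := fact3 B C u u (by omega)
  have d2 := fact3 B C u (2*u) (by omega)
  have d3 := fact3 B C u (3*u) (by omega)
  have g0 := fact7 B C u 0 hu (by omega) (by omega)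
  have g1 := fact7 B C u u hu (by omega) (by omega)
  have p0 := fact4 B C u 0 u hu
  have p1 := fact4 B C u u u hu
  have p2 := fact4 B C u (2*u) u hu
  have p3 := fact4 B C u (3*u) u hu
  have q0 := fact4 B C u 0 (-u) hu.neg
  have q1 := fact4 B C u u (-u) hu.neg
  have q2 := fact4 B C u (2*u) (-u) hu.neg
  have q3 := fact4 B C u (3*u) (-u) hu.neg
  have r0 := fact5 B C u 0
  have r1 := fact5 B C u u
  have r2 := fact5 B C u (2*u)
  have r3 := fact5 B C u (3*u)
  have s := fact6 B C u hu
  rw [z0] at q0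
  rw [z1] at q1
  rw [z2] at q2
  rw [z3] at q3
  simp only [c0, c3, c4, e1, e2, zero_add] at b0 b1 b2 b3 g0 g1 p0 p1 p2 p3 r0 r1 r2 r3
  clear c0 c3 c4 e1 e2 z0 z1 z2 z3
  generalize (cls B 0).card = x0 at *
  generalize (cls B u).card = x1 at *
  generalize (cls B (2*u)).card = x2 at *
  generalize (cls B (3*u)).card = x3 at *
  generalize (cls (S B C u) 0).card = f0 at *
  generalize (cls (S B C u) u).card = f1 at *
  generalize (cls (S B C u) (2*u)).card = f2 at *
  generalize (cls (S B C u) (3*u)).card = f3 at *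
  generalize (S B C u).card = f at *
  generalize B.card = k at *
  generalize C.card = n at *
  have hx0 : x0 ≤ 4 := by omega
  have hx1 : x1 ≤ 4 := by omega
  have hx2 : x2 ≤ 4 := by omega
  subst sB
  interval_cases x0 <;> interval_cases x1 <;> first | (exfalso; clear * - hB4; omega) | skip
  all_goals
    interval_cases x2 <;> first | (exfalso; clear * - hB4; omega) | skip
  all_goals
    have hx3 : x3 ≤ 4 := by omega
    interval_cases x3 <;> first | (exfalso; clear * - hB4; omega) | (simp at *; done) | (simp at *; omega)

lemma main (A : Finset ℤ) (hA : 5 ≤ A.card) (r₁ r₂ : ℤ) (hodd : Odd (r₂ - r₁))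
    (hcov : ∀ a ∈ A, a % 4 = r₁ ∨ a % 4 = r₂) (h1 : ∃ a ∈ A, a % 4 = r₁)
    (h2 : ∃ a ∈ A, a % 4 = r₂) (h4 : (A.filter (fun a => a % 4 = r₁)).card ≤ 4) :
    (A.card : ℤ) + 3 * (A.filter (fun a => a % 4 = r₁)).card - 3 ≤
        (((A.filter (fun a => a % 4 = r₁)) + A.image (fun b => (4 : ℤ) * b)).card : ℤ) := by
  obtain ⟨B, hB⟩ := exists_dil (A.filter (fun a => a % 4 = r₁)) r₁ (by
    intro x hx
    have := (mem_filter.1 hx).2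
    omega)
  obtain ⟨C, hC⟩ := exists_dil (A.filter (fun a => a % 4 = r₂)) r₂ (by
    intro x hx
    have := (mem_filter.1 hx).2
    omega)
  have hU : A = dil B r₁ ∪ dil C r₂ := by
    rw [← hB, ← hC]
    ext a
    simp only [mem_union, mem_filter]
    constructor
    · intro ha
      rcases hcov a ha with h | h
      · exact Or.inl ⟨ha, h⟩
      · exact Or.inr ⟨ha, h⟩
    · tauto
  have hcard : A.card = B.card + C.card := by
    rw [← card_dil B r₁, ← card_dil C r₂, ← hB, ← hC, ← card_union_of_disjoint, hB, hC, ← hU]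
    rw [disjoint_left]
    intro t ht ht'
    have e1 := (mem_filter.1 ht).2
    have e2 := (mem_filter.1 ht').2
    obtain ⟨v, hv⟩ := hodd
    omega
  have hBp : 1 ≤ B.card := by
    rw [← card_dil B r₁, ← hB]
    obtain ⟨a, ha, ha'⟩ := h1
    exact card_pos.2 ⟨a, mem_filter.2 ⟨ha, ha'⟩⟩
  have hCp : 1 ≤ C.card := by
    rw [← card_dil C r₂, ← hC]
    obtain ⟨a, ha, ha'⟩ := h2
    exact card_pos.2 ⟨a, mem_filter.2 ⟨ha, ha'⟩⟩
  rw [hB, card_dil] at h4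
  have hcore := core B C (r₂ - r₁) hodd hBp h4 hCp (by omega)
  have hle : (S B C (r₂ - r₁)).card ≤
      (A.filter (fun a => a % 4 = r₁) + A.image (fun b => (4 : ℤ) * b)).card := by
    rw [← card_dil _ (5 * r₁), hB]
    apply card_le_card
    intro t ht
    simp only [S, mem_dil, mem_add, mem_union] at ht
    obtain ⟨_, ⟨p, hp, _, ⟨q, hq, rfl⟩ | ⟨q, hq, rfl⟩, rfl⟩, rfl⟩ := ht
    · refine mem_add.2 ⟨_, mem_dil.2 ⟨p, hp, rfl⟩, 4 * (4 * q + r₁), ?_, by ring⟩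
      refine mem_image.2 ⟨_, ?_, rfl⟩
      rw [hU]
      exact mem_union_left _ (mem_dil.2 ⟨q, hq, rfl⟩)
    · refine mem_add.2 ⟨_, mem_dil.2 ⟨p, hp, rfl⟩, 4 * (4 * q + r₂), ?_, by ring⟩
      refine mem_image.2 ⟨_, ?_, rfl⟩
      rw [hU]
      exact mem_union_right _ (mem_dil.2 ⟨q, hq, rfl⟩)
  have hk : (A.filter (fun a => a % 4 = r₁)).card = B.card := by rw [hB, card_dil]
  rw [hk]
  omega

end Stmt17

/-- Let `A` be a finite set of integers with `|A| ≥ 5` attaining exactly 2 distinct residues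
modulo 4, namely `0` and an odd residue `u₂`, with residue classes `A₁ = {a ∈ A : a ≡ 0}`
and `A₂ = {a ∈ A : a ≡ u₂}` modulo 4. Then for each `i ∈ {1, 2}` with `|A_i| ≤ 4`,
`|A_i + 4·A| ≥ |A| + 3|A_i| − 3`. -/
theorem stmt_17 (A : Finset ℤ) (hA : 5 ≤ A.card)
    (u₂ : ℤ) (hodd : Odd u₂)
    (himg : A.image (fun a => a % 4) = {0, u₂}) :
    ((A.filter (fun a => a % 4 = 0)).card ≤ 4 →
      (A.card : ℤ) + 3 * (A.filter (fun a => a % 4 = 0)).card - 3 ≤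
        (((A.filter (fun a => a % 4 = 0)) + A.image (fun b => (4 : ℤ) * b)).card : ℤ)) ∧
    ((A.filter (fun a => a % 4 = u₂)).card ≤ 4 →
      (A.card : ℤ) + 3 * (A.filter (fun a => a % 4 = u₂)).card - 3 ≤
        (((A.filter (fun a => a % 4 = u₂)) + A.image (fun b => (4 : ℤ) * b)).card : ℤ)) := by
  have hcov : ∀ a ∈ A, a % 4 = 0 ∨ a % 4 = u₂ := by
    intro a ha
    have : a % 4 ∈ A.image (fun a => a % 4) := mem_image.2 ⟨a, ha, rfl⟩
    rw [himg] at this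
    simpa using this
  have h1 : ∃ a ∈ A, a % 4 = 0 := by
    have : (0:ℤ) ∈ A.image (fun a => a % 4) := by rw [himg]; simp
    exact mem_image.1 this
  have h2 : ∃ a ∈ A, a % 4 = u₂ := by
    have : u₂ ∈ A.image (fun a => a % 4) := by rw [himg]; simp
    exact mem_image.1 this
  refine ⟨fun h => Stmt17.main A hA 0 u₂ (by simpa using hodd) hcov h1 h2 h,
    fun h => Stmt17.main A hA u₂ 0 (by simpa using hodd.neg) (fun a ha => (hcov a ha).symm) h2 h1 h⟩
end
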